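/- arXiv:1610.00781 — 5 statements merged into one kernel-verified Lean document; each statement's English description precedes it below -/
import Mathlib

section
/- Let G ∈ ℝ^{d×d} with spectral radius ρ(G) < 1 and Σ ∈ ℝ^{d×d} symmetric positive definite, and define 𝒜 := (∑_{l=0}^∞ G^l Σ (Gᵀ)^l)^{-1}. If GΣ is symmetric, then Σ^{-1}G is also symmetric and 𝒜 = Σ^{-1}(I − G²) = Σ^{-1} − Gᵀ Σ^{-1} G. -/
noncomputable section

open MeasureTheory Matrix Filter Topology

namespace AR1

/-- Density of the Gaussian distribution on `ℝ^d` with mean `m` and *precision* matrix `P`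
(covariance `P⁻¹`). -/
def gaussDensity {d : ℕ} (m : Fin d → ℝ) (P : Matrix (Fin d) (Fin d) ℝ)
    (x : Fin d → ℝ) : ℝ :=
  Real.sqrt (P.det / (2 * Real.pi) ^ d) *
    Real.exp (-(1 / 2) * ((x - m) ⬝ᵥ (P *ᵥ (x - m))))

/-- Gaussian measure on `ℝ^d` with mean `m` and precision matrix `P`. -/
def gaussMeasure {d : ℕ} (m : Fin d → ℝ) (P : Matrix (Fin d) (Fin d) ℝ) :
    Measure (Fin d → ℝ) :=
  volume.withDensity fun x => ENNReal.ofReal (gaussDensity m P x)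

/-- Transition density of the stochastic AR(1) proposal `y = G x + g + ν`, `ν ~ N(0, S)`. -/
def propDensity {d : ℕ} (G : Matrix (Fin d) (Fin d) ℝ) (g : Fin d → ℝ)
    (S : Matrix (Fin d) (Fin d) ℝ) (x y : Fin d → ℝ) : ℝ :=
  gaussDensity (G *ᵥ x + g) S⁻¹ y

/-- Metropolis–Hastings acceptance probability for target density `tden` and proposal
transition density `qden`. -/
def accept {d : ℕ} (tden : (Fin d → ℝ) → ℝ) (qden : (Fin d → ℝ) → (Fin d → ℝ) → ℝ)
    (x y : Fin d → ℝ) : ℝ :=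
  min 1 (tden y * qden y x / (tden x * qden x y))

/-- Joint law of (current state, proposal) when the chain is in equilibrium. -/
def jointMeasure {d : ℕ} (tden : (Fin d → ℝ) → ℝ)
    (qden : (Fin d → ℝ) → (Fin d → ℝ) → ℝ) :
    Measure ((Fin d → ℝ) × (Fin d → ℝ)) :=
  volume.withDensity fun pr => ENNReal.ofReal (tden pr.1 * qden pr.1 pr.2)

/-- Expected Metropolis–Hastings acceptance probability in equilibrium. -/
def expAccept {d : ℕ} (tden : (Fin d → ℝ) → ℝ)
    (qden : (Fin d → ℝ) → (Fin d → ℝ) → ℝ) : ℝ :=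
  ∫ pr, accept tden qden pr.1 pr.2 ∂(jointMeasure tden qden)

/-- Expected squared jump size in direction `v`, in equilibrium:
`E[(vᵀ(x' - x))²]` where `x'` is the next state of the Metropolis–Hastings chain. -/
def expSqJump {d : ℕ} (tden : (Fin d → ℝ) → ℝ)
    (qden : (Fin d → ℝ) → (Fin d → ℝ) → ℝ) (v : Fin d → ℝ) : ℝ :=
  ∫ pr, (v ⬝ᵥ (pr.2 - pr.1)) ^ 2 * accept tden qden pr.1 pr.2 ∂(jointMeasure tden qden)

/-- `Z = log (π(y) q(y,x) / (π(x) q(x,y)))`. -/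
def logRatio {d : ℕ} (tden : (Fin d → ℝ) → ℝ)
    (qden : (Fin d → ℝ) → (Fin d → ℝ) → ℝ)
    (pr : (Fin d → ℝ) × (Fin d → ℝ)) : ℝ :=
  Real.log (tden pr.2 * qden pr.2 pr.1 / (tden pr.1 * qden pr.1 pr.2))

/-- Standard normal cumulative distribution function `Φ`. -/
def stdNormalCDF (z : ℝ) : ℝ :=
  (ProbabilityTheory.gaussianReal 0 1 (Set.Iic z)).toReal

/-- `Φ(μ/σ) + e^{μ + σ²/2} Φ(-σ - μ/σ)`. -/
def acceptLimit (μ σ : ℝ) : ℝ :=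
  stdNormalCDF (μ / σ) + Real.exp (μ + σ ^ 2 / 2) * stdNormalCDF (-σ - μ / σ)

/-- Normalized density of the target `π_d` with `dπ_d/dπ̃_d = exp(-φ)`,
`π̃_d = N(m, A⁻¹)` (precision `A`). -/
def ngDensity {d : ℕ} (φ : (Fin d → ℝ) → ℝ) (m : Fin d → ℝ)
    (A : Matrix (Fin d) (Fin d) ℝ) (x : Fin d → ℝ) : ℝ :=
  Real.exp (-(φ x)) * gaussDensity m A x /
    ∫ y, Real.exp (-(φ y)) * gaussDensity m A y

/-- Real power `A^s` of a symmetric positive definite matrix `A = Q diag(lam2) Qᵀ`. -/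
def apow {d : ℕ} (Q : Matrix (Fin d) (Fin d) ℝ) (lam2 : Fin d → ℝ) (s : ℝ) :
    Matrix (Fin d) (Fin d) ℝ :=
  Q * Matrix.diagonal (fun i => lam2 i ^ s) * Qᵀ

/-- The norm `|x|_s = |A^s x|` associated with `A = Q diag(lam2) Qᵀ`. -/
def anorm {d : ℕ} (Q : Matrix (Fin d) (Fin d) ℝ) (lam2 : Fin d → ℝ) (s : ℝ)
    (v : Fin d → ℝ) : ℝ :=
  Real.sqrt ((apow Q lam2 s *ᵥ v) ⬝ᵥ (apow Q lam2 s *ᵥ v))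

end AR1

namespace AR1

/-- In a complex Banach algebra, the powers of an element of spectral radius less than one are
summable. -/
theorem summable_pow_of_spectralRadius_lt_one {A : Type*} [NormedRing A] [NormedAlgebra ℂ A]
    [CompleteSpace A] {a : A} (ha : spectralRadius ℂ a < 1) : Summable fun n : ℕ => a ^ n := by
  obtain ⟨r, har, hr⟩ := ENNReal.lt_iff_exists_nnreal_btwn.1 ha
  have hr' : (r : ℝ) < 1 := by exact_mod_cast hr
  refine Summable.of_norm_bounded_eventually_nat (summable_geometric_of_lt_one r.2 hr') ?_
  filter_upwards [(spectrum.pow_nnnorm_pow_one_div_tendsto_nhds_spectralRadius a).eventually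
    (gt_mem_nhds har), eventually_gt_atTop 0] with n hn hn0
  have hpos : (0 : ℝ) < n := by exact_mod_cast hn0
  have h := ENNReal.rpow_le_rpow hn.le hpos.le
  rw [← ENNReal.rpow_mul, one_div_mul_cancel hpos.ne', ENNReal.rpow_one,
    ENNReal.rpow_natCast] at h
  exact_mod_cast h

section

attribute [local instance] Matrix.linftyOpNormedRing Matrix.linftyOpNormedAlgebra

/-- The powers of a complex matrix of spectral radius less than one are summable. -/
theorem summable_matrix_pow_of_spectralRadius_lt_one {n : Type*} [Fintype n] [DecidableEq n]
    {M : Matrix n n ℂ} (hM : spectralRadius ℂ M < 1) : Summable fun k : ℕ => M ^ k :=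
  summable_pow_of_spectralRadius_lt_one hM

end

/-- The powers of a real matrix of spectral radius less than one are summable. -/
theorem summable_real_matrix_pow_of_spectralRadius_lt_one {n : Type*} [Fintype n] [DecidableEq n]
    {M : Matrix n n ℝ} (hM : spectralRadius ℂ (M.map Complex.ofReal) < 1) :
    Summable fun k : ℕ => M ^ k := by
  have h := summable_matrix_pow_of_spectralRadius_lt_one hM
  refine Pi.summable.2 fun i => Pi.summable.2 fun j => ?_
  refine Complex.summable_ofReal.1 ((Pi.summable.1 (Pi.summable.1 h i) j).congr fun k => ?_)
  exact (congrFun₂ (map_pow Complex.ofRealHom.mapMatrix M k) i j).symm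

/-- If `ρ(G) < 1`, `Σ` s.p.d., `𝒜 := (∑ Gˡ Σ (Gᵀ)ˡ)⁻¹`, and `GΣ` is
symmetric, then `Σ⁻¹G` is symmetric and `𝒜 = Σ⁻¹(I − G²) = Σ⁻¹ − Gᵀ Σ⁻¹ G`. -/
theorem stmt_2 {d : ℕ} (G S : Matrix (Fin d) (Fin d) ℝ)
    (hρ : spectralRadius ℂ (G.map Complex.ofReal) < 1)
    (hS : S.PosDef)
    (hGS : (G * S)ᵀ = G * S) :
    (S⁻¹ * G)ᵀ = S⁻¹ * G ∧
    (∑' l : ℕ, G ^ l * S * (Gᵀ) ^ l)⁻¹ = S⁻¹ * (1 - G ^ 2) ∧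
    (∑' l : ℕ, G ^ l * S * (Gᵀ) ^ l)⁻¹ = S⁻¹ - Gᵀ * S⁻¹ * G := by
  have hdet : IsUnit S.det := S.isUnit_iff_isUnit_det.1 hS.isUnit
  have hST : Sᵀ = S := by simpa using hS.isHermitian.eq
  have hcomm : G * S = S * Gᵀ := by rw [← hGS, transpose_mul, hST]
  have hinv : S⁻¹ * G = Gᵀ * S⁻¹ := by
    calc S⁻¹ * G = S⁻¹ * (G * S) * S⁻¹ := by
          rw [Matrix.mul_assoc, Matrix.mul_assoc, mul_nonsing_inv _ hdet, Matrix.mul_one]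
      _ = Gᵀ * S⁻¹ := by
          rw [hcomm, ← Matrix.mul_assoc, nonsing_inv_mul _ hdet, Matrix.one_mul]
  have hterm (l : ℕ) : G ^ l * S * Gᵀ ^ l = (G ^ 2) ^ l * S := by
    have hl : SemiconjBy S (Gᵀ ^ l) (G ^ l) := SemiconjBy.pow_right hcomm.symm l
    rw [Matrix.mul_assoc, hl.eq, ← Matrix.mul_assoc, ← pow_add, ← pow_mul, two_mul]
  have hsum : Summable fun l : ℕ => (G ^ 2) ^ l := by
    simp only [← pow_mul]
    exact (summable_real_matrix_pow_of_spectralRadius_lt_one hρ).comp_injective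
      (mul_right_injective₀ (two_ne_zero (α := ℕ)))
  have hmain : (∑' l : ℕ, G ^ l * S * Gᵀ ^ l)⁻¹ = S⁻¹ * (1 - G ^ 2) := by
    simp only [hterm]
    rw [hsum.tsum_mul_right]
    refine inv_eq_left_inv ?_
    rw [Matrix.mul_assoc, ← Matrix.mul_assoc (1 - G ^ 2), hsum.one_sub_mul_tsum_pow,
      Matrix.one_mul, nonsing_inv_mul _ hdet]
  refine ⟨?_, hmain, ?_⟩
  · rw [transpose_mul, transpose_nonsing_inv, hST, hinv]
  · rw [hmain, ← hinv, Matrix.mul_sub, Matrix.mul_one, Matrix.mul_assoc, pow_two]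

end AR1
end
end

section
/- Let G ∈ ℝ^{d×d} with spectral radius ρ(G) < 1, g ∈ ℝ^d, Σ ∈ ℝ^{d×d} symmetric positive definite, and suppose GΣ is symmetric. Define 𝒜 := (∑_{l=0}^∞ G^l Σ (Gᵀ)^l)^{-1} and β := 𝒜(I−G)^{-1}g. Then the Markov transition kernel of the stochastic AR(1) process y = Gx + g + ν, ν ~ N(0,Σ), is reversible with respect to N(𝒜^{-1}β, 𝒜^{-1}); that is, detailed balance π*(x) q(x,y) = π*(y) q(y,x) holds for all x,y ∈ ℝ^d, where π*(x) ∝ exp(−½ xᵀ𝒜x + βᵀx) and q(x,y) ∝ exp(−½ (y−Gx−g)ᵀ Σ^{-1} (y−Gx−g)). -/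
noncomputable section

open MeasureTheory Matrix Filter Topology

namespace AR1

section Powers

attribute [local instance] Matrix.linftyOpNormedRing Matrix.linftyOpNormedAlgebra

/-- The powers of a complex matrix of spectral radius less than one are summable. -/
theorem summable_pow_of_spectralRadius_lt_one_s3 {d : ℕ} (M : Matrix (Fin d) (Fin d) ℂ)
    (hM : spectralRadius ℂ M < 1) : Summable fun n : ℕ => M ^ n := by
  obtain ⟨r, hMr, hr⟩ := ENNReal.lt_iff_exists_nnreal_btwn.mp hM
  have hr' : r < 1 := by exact_mod_cast hr
  have hlim := spectrum.pow_nnnorm_pow_one_div_tendsto_nhds_spectralRadius M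
  have hbound : ∀ᶠ n : ℕ in atTop, ‖M ^ n‖ ≤ (r : ℝ) ^ n := by
    filter_upwards [hlim.eventually_lt_const hMr, eventually_gt_atTop 0] with n hn hpos
    have hroot : (‖M ^ n‖₊ : ENNReal) ≤ (r : ENNReal) ^ n := by
      rw [one_div, ENNReal.rpow_inv_lt_iff (by exact_mod_cast hpos), ENNReal.rpow_natCast] at hn
      exact hn.le
    exact_mod_cast hroot
  exact Summable.of_norm_bounded_eventually_nat
    (summable_geometric_of_lt_one r.coe_nonneg (by exact_mod_cast hr')) hbound

end Powers

/-- The powers of a real matrix of complex spectral radius less than one are summable. -/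
theorem summable_pow_of_spectralRadius_map_lt_one {d : ℕ} (G : Matrix (Fin d) (Fin d) ℝ)
    (hG : spectralRadius ℂ (G.map Complex.ofReal) < 1) : Summable fun n : ℕ => G ^ n := by
  have h := summable_pow_of_spectralRadius_lt_one_s3 _ hG
  have hre := h.map (Complex.reCLM.toLinearMap.toAddMonoidHom.mapMatrix (m := Fin d) (n := Fin d))
    (continuous_id.matrix_map Complex.continuous_re)
  refine hre.congr fun n => ?_
  have hn : G.map Complex.ofReal ^ n = (G ^ n).map Complex.ofReal :=
    (map_pow (Complex.ofRealHom.mapMatrix (m := Fin d)) G n).symm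
  ext i j
  simp [hn]

/-- If the powers of `G` are summable and `S * Gᵀ = G * S`, then the stationary covariance of
the AR(1) process has inverse `S⁻¹ * (1 - G * G)`. -/
theorem inv_tsum_pow_mul_mul_pow {d : ℕ} {G S : Matrix (Fin d) (Fin d) ℝ}
    (hG : Summable fun n : ℕ => G ^ n) (hS : S * Gᵀ = G * S) :
    (∑' l : ℕ, G ^ l * S * (Gᵀ) ^ l)⁻¹ = S⁻¹ * (1 - G * G) := by
  have hcomm : ∀ l : ℕ, S * Gᵀ ^ l = G ^ l * S := fun l =>
    (SemiconjBy.pow_right (show SemiconjBy S Gᵀ G from hS) l).eq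
  have hterm : ∀ l : ℕ, G ^ l * S * Gᵀ ^ l = (G * G) ^ l * S := fun l => by
    rw [mul_assoc, hcomm, ← mul_assoc, ← (Commute.refl G).mul_pow]
  have hsq : Summable fun l : ℕ => (G * G) ^ l := by
    refine (hG.comp_injective (mul_right_injective₀ (two_ne_zero' ℕ))).congr fun l => ?_
    simp [pow_mul, sq]
  rw [tsum_congr hterm, hsq.tsum_mul_right S, Matrix.mul_inv_rev,
    Matrix.inv_eq_right_inv (hsq.tsum_pow_mul_one_sub)]

/-- The AR(1) exponent is symmetric in the current and the proposed state when `G` is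
self-adjoint for the inner product given by `K`. -/
theorem exponent_symm {d : ℕ} {G K : Matrix (Fin d) (Fin d) ℝ} (hK : Kᵀ = K)
    (hKG : Gᵀ * K = K * G) (g x y : Fin d → ℝ) :
    -(1 / 2) * (x ⬝ᵥ ((K * (1 - G * G)) *ᵥ x)) + ((K * (1 + G)) *ᵥ g) ⬝ᵥ x +
        -(1 / 2) * ((y - G *ᵥ x - g) ⬝ᵥ (K *ᵥ (y - G *ᵥ x - g))) =
      -(1 / 2) * (y ⬝ᵥ ((K * (1 - G * G)) *ᵥ y)) + ((K * (1 + G)) *ᵥ g) ⬝ᵥ y +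
        -(1 / 2) * ((x - G *ᵥ y - g) ⬝ᵥ (K *ᵥ (x - G *ᵥ y - g))) := by
  have hsymm : ∀ u v : Fin d → ℝ, u ⬝ᵥ (K *ᵥ v) = v ⬝ᵥ (K *ᵥ u) := fun u v => by
    rw [dotProduct_mulVec, ← mulVec_transpose, hK, dotProduct_comm]
  have hadj : ∀ u v : Fin d → ℝ, (G *ᵥ u) ⬝ᵥ (K *ᵥ v) = u ⬝ᵥ (K *ᵥ (G *ᵥ v)) := fun u v => by
    rw [mulVec_mulVec, ← hKG, ← mulVec_mulVec, dotProduct_mulVec u, vecMul_transpose]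
  simp only [mul_sub, mul_add, mul_one, sub_mulVec, add_mulVec, ← mulVec_mulVec, mulVec_sub,
    dotProduct_sub, sub_dotProduct, add_dotProduct, hadj]
  rw [dotProduct_comm (K *ᵥ g) x, dotProduct_comm (K *ᵥ g) y,
    dotProduct_comm (K *ᵥ (G *ᵥ g)) x, dotProduct_comm (K *ᵥ (G *ᵥ g)) y,
    hsymm g x, hsymm g y, hsymm g (G *ᵥ x), hsymm g (G *ᵥ y), hsymm y (G *ᵥ x),
    hadj, hadj, hadj]
  ring

/-- If `ρ(G) < 1`, `Σ` s.p.d. and `GΣ` symmetric, then the stochastic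
AR(1) transition kernel is reversible with respect to `N(𝒜⁻¹β, 𝒜⁻¹)`: detailed balance
`π*(x) q(x,y) = π*(y) q(y,x)` holds, where `π*(x) ∝ exp(−½ xᵀ𝒜x + βᵀx)` and
`q(x,y) ∝ exp(−½ (y−Gx−g)ᵀ Σ⁻¹ (y−Gx−g))`, with `𝒜 := (∑ Gˡ Σ (Gᵀ)ˡ)⁻¹` and
`β := 𝒜 (I−G)⁻¹ g`. -/
theorem stmt_3 {d : ℕ} (G S : Matrix (Fin d) (Fin d) ℝ) (g : Fin d → ℝ)
    (hρ : spectralRadius ℂ (G.map Complex.ofReal) < 1)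
    (hS : S.PosDef)
    (hGS : (G * S)ᵀ = G * S) :
    ∀ x y : Fin d → ℝ,
      Real.exp (-(1 / 2) * (x ⬝ᵥ ((∑' l : ℕ, G ^ l * S * (Gᵀ) ^ l)⁻¹ *ᵥ x)) +
          ((∑' l : ℕ, G ^ l * S * (Gᵀ) ^ l)⁻¹ *ᵥ ((1 - G)⁻¹ *ᵥ g)) ⬝ᵥ x) *
        Real.exp (-(1 / 2) * ((y - G *ᵥ x - g) ⬝ᵥ (S⁻¹ *ᵥ (y - G *ᵥ x - g)))) =
      Real.exp (-(1 / 2) * (y ⬝ᵥ ((∑' l : ℕ, G ^ l * S * (Gᵀ) ^ l)⁻¹ *ᵥ y)) +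
          ((∑' l : ℕ, G ^ l * S * (Gᵀ) ^ l)⁻¹ *ᵥ ((1 - G)⁻¹ *ᵥ g)) ⬝ᵥ y) *
        Real.exp (-(1 / 2) * ((x - G *ᵥ y - g) ⬝ᵥ (S⁻¹ *ᵥ (x - G *ᵥ y - g)))) := by
  have hsum := summable_pow_of_spectralRadius_map_lt_one G hρ
  have hSt : Sᵀ = S := by simpa using hS.isHermitian.eq
  have hSG : S * Gᵀ = G * S := by rw [← hGS, transpose_mul, hSt]
  have hSdet : IsUnit S.det := (Matrix.isUnit_iff_isUnit_det S).mp hS.isUnit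
  have hKt : (S⁻¹)ᵀ = S⁻¹ := by rw [transpose_nonsing_inv, hSt]
  have hKG : Gᵀ * S⁻¹ = S⁻¹ * G := by
    calc Gᵀ * S⁻¹ = S⁻¹ * (S * Gᵀ) * S⁻¹ := by rw [nonsing_inv_mul_cancel_left _ _ hSdet]
      _ = S⁻¹ * G := by rw [hSG, ← mul_assoc, mul_nonsing_inv_cancel_right _ _ hSdet]
  have hdet : IsUnit (1 - G).det :=
    (Matrix.isUnit_iff_isUnit_det _).mp
      (.of_mul_eq_one _ hsum.one_sub_mul_tsum_pow)
  have hβ : S⁻¹ * (1 - G * G) * (1 - G)⁻¹ = S⁻¹ * (1 + G) := by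
    rw [show 1 - G * G = (1 + G) * (1 - G) by noncomm_ring, ← mul_assoc,
      mul_nonsing_inv_cancel_right _ _ hdet]
  intro x y
  rw [inv_tsum_pow_mul_mul_pow hsum hSG, mulVec_mulVec, hβ, ← Real.exp_add, ← Real.exp_add,
    exponent_symm hKt hKG g x y]

end AR1
end
end

section
/- Consider the Metropolis–Hastings algorithm on ℝ^d with target density π̃_d(x) ∝ exp(−½ xᵀAx + bᵀx) (A symmetric positive definite, b ∈ ℝ^d) and stochastic AR(1) proposal y = Gx + g + ν, ν ~ N(0,Σ), with ρ(G) < 1 and GΣ symmetric. With 𝒜 := (∑_{l=0}^∞ G^l Σ (Gᵀ)^l)^{-1} and β := 𝒜(I−G)^{-1}g, the Metropolis–Hastings acceptance probability satisfies α(x,y) = min{1, exp(−½ yᵀ(A−𝒜)y + ½ xᵀ(A−𝒜)x + (b−β)ᵀ(y−x))}. -/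
noncomputable section

open MeasureTheory Matrix Filter Topology

namespace AR1

open scoped NNReal ENNReal

/-- In a complex Banach algebra, the powers of an element of spectral radius less than one are
absolutely summable. -/
theorem summable_norm_pow_of_spectralRadius_lt_one {R : Type*} [NormedRing R] [NormedAlgebra ℂ R]
    [CompleteSpace R] {a : R} (ha : spectralRadius ℂ a < 1) :
    Summable fun n : ℕ => ‖a ^ n‖ := by
  obtain ⟨r, har, hr⟩ := ENNReal.lt_iff_exists_nnreal_btwn.1 ha
  have hr1 : (r : ℝ) < 1 := by exact_mod_cast hr
  refine Summable.of_norm_bounded_eventually_nat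
    (summable_geometric_of_lt_one r.coe_nonneg hr1) ?_
  filter_upwards [(spectrum.pow_nnnorm_pow_one_div_tendsto_nhds_spectralRadius a).eventually_lt_const
    har, eventually_gt_atTop 0] with n hn hpos
  have h1 : (‖a ^ n‖₊ : ℝ≥0∞) ≤ (r : ℝ≥0∞) ^ n := by
    have h2 := ENNReal.rpow_le_rpow hn.le (Nat.cast_nonneg (α := ℝ) n)
    rwa [← ENNReal.rpow_mul, one_div_mul_cancel (by positivity), ENNReal.rpow_one,
      ENNReal.rpow_natCast] at h2
  have h3 : ‖a ^ n‖₊ ≤ r ^ n := by exact_mod_cast h1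
  rw [norm_norm]
  exact_mod_cast h3

section LinftyOp

attribute [local instance] Matrix.linftyOpNormedRing Matrix.linftyOpNormedAlgebra

theorem norm_entry_le_linfty_opNorm {n : Type*} [Fintype n] [DecidableEq n]
    (M : Matrix n n ℂ) (i j : n) : ‖M i j‖ ≤ ‖M‖ := by
  have h1 : ‖M i j‖₊ ≤ ∑ k, ‖M i k‖₊ :=
    Finset.single_le_sum (f := fun k => ‖M i k‖₊) (fun _ _ => zero_le) (Finset.mem_univ j)
  have h2 : ∑ k, ‖M i k‖₊ ≤ ‖M‖₊ := by
    rw [Matrix.linfty_opNNNorm_def]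
    exact Finset.le_sup (f := fun i => ∑ k, ‖M i k‖₊) (Finset.mem_univ i)
  exact_mod_cast h1.trans h2

theorem summable_norm_pow_entry {n : Type*} [Fintype n] [DecidableEq n] {M : Matrix n n ℂ}
    (hM : spectralRadius ℂ M < 1) (i j : n) : Summable fun l : ℕ => ‖(M ^ l) i j‖ :=
  Summable.of_nonneg_of_le (fun _ => norm_nonneg _)
    (fun l => norm_entry_le_linfty_opNorm (M ^ l) i j)
    (summable_norm_pow_of_spectralRadius_lt_one hM)

theorem isUnit_algebraMap_sub_of_spectralRadius_lt_one {n : Type*} [Fintype n] [DecidableEq n]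
    {M : Matrix n n ℂ} (hM : spectralRadius ℂ M < 1) {z : ℂ} (hz : ‖z‖ = 1) :
    IsUnit (algebraMap ℂ (Matrix n n ℂ) z - M) := by
  have h : z ∈ resolventSet ℂ M := by
    apply spectrum.mem_resolventSet_of_spectralRadius_lt
    have : ‖z‖₊ = 1 := NNReal.eq hz
    simpa [this] using hM
  exact h

end LinftyOp

section RealMatrix

variable {n : Type*} [Fintype n] [DecidableEq n]

theorem summable_pow_of_spectralRadius_lt_one_s5 {G : Matrix n n ℝ}
    (hρ : spectralRadius ℂ (G.map Complex.ofReal) < 1) : Summable fun l : ℕ => G ^ l := by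
  refine Pi.summable.2 fun i => Pi.summable.2 fun j => ?_
  refine Summable.of_norm ((summable_norm_pow_entry hρ i j).congr fun l => ?_)
  have h : (G.map Complex.ofReal) ^ l = (G ^ l).map Complex.ofReal :=
    (map_pow Complex.ofRealHom.mapMatrix G l).symm
  rw [h, Matrix.map_apply, Complex.norm_real]

theorem isUnit_of_isUnit_map_ofReal {M : Matrix n n ℝ} (h : IsUnit (M.map Complex.ofReal)) :
    IsUnit M := by
  rw [Matrix.isUnit_iff_isUnit_det, isUnit_iff_ne_zero] at h ⊢
  intro h0
  apply h
  have := Complex.ofRealHom.map_det M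
  rw [h0, map_zero] at this
  exact this.symm

theorem isUnit_one_sub_of_spectralRadius_lt_one {G : Matrix n n ℝ}
    (hρ : spectralRadius ℂ (G.map Complex.ofReal) < 1) : IsUnit (1 - G) := by
  apply isUnit_of_isUnit_map_ofReal
  have h := isUnit_algebraMap_sub_of_spectralRadius_lt_one hρ (z := 1) norm_one
  rw [map_one] at h
  convert h using 1
  exact (map_sub Complex.ofRealHom.mapMatrix 1 G).trans (by rw [map_one]; rfl)

/-- If `G * S` is symmetric, the equilibrium covariance of the AR(1) process sums to
`(1 - G²)⁻¹ S`. -/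
theorem one_sub_mul_tsum_pow_mul_mul_pow_transpose {G S : Matrix n n ℝ}
    (hρ : spectralRadius ℂ (G.map Complex.ofReal) < 1) (hGS : G * S = S * Gᵀ) :
    (1 - G * G) * ∑' l : ℕ, G ^ l * S * (Gᵀ) ^ l = S := by
  have hterm : ∀ l : ℕ, G ^ l * S * (Gᵀ) ^ l = G ^ (2 * l) * S := fun l => by
    have h : G ^ l * S = S * (Gᵀ) ^ l :=
      (SemiconjBy.pow_right (a := S) (x := Gᵀ) (y := G) hGS.symm l).symm
    rw [mul_assoc, ← h, ← mul_assoc, ← pow_add, two_mul]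
  have hsum : Summable fun l : ℕ => G ^ (2 * l) * S :=
    ((summable_pow_of_spectralRadius_lt_one_s5 hρ).comp_injective
      (mul_right_injective₀ two_ne_zero)).mul_right S
  simp_rw [hterm]
  have h0 := hsum.tsum_eq_zero_add
  have h1 : ∑' l : ℕ, G ^ (2 * (l + 1)) * S = G * G * ∑' l : ℕ, G ^ (2 * l) * S := by
    rw [← hsum.tsum_mul_left]
    congr 1
    ext1 l
    rw [← mul_assoc, ← pow_two, ← pow_add, mul_add, mul_one, add_comm]
  rw [h1] at h0
  rw [sub_mul, one_mul, sub_eq_iff_eq_add]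
  simpa using h0

end RealMatrix

/-- The Metropolis–Hastings log ratio of a Gaussian target and a linear Gaussian proposal whose
drift `G` is self-adjoint for the precision `P`. -/
theorem gaussian_log_ratio {d : ℕ} {A P G : Matrix (Fin d) (Fin d) ℝ} (m g : Fin d → ℝ)
    (hA : Aᵀ = A) (hP : Pᵀ = P) (hPG : P * G = Gᵀ * P) (x y : Fin d → ℝ) :
    -(1 / 2) * ((y - m) ⬝ᵥ (A *ᵥ (y - m))) +
        -(1 / 2) * ((x - (G *ᵥ y + g)) ⬝ᵥ (P *ᵥ (x - (G *ᵥ y + g)))) -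
      (-(1 / 2) * ((x - m) ⬝ᵥ (A *ᵥ (x - m))) +
        -(1 / 2) * ((y - (G *ᵥ x + g)) ⬝ᵥ (P *ᵥ (y - (G *ᵥ x + g))))) =
      -(1 / 2) * (y ⬝ᵥ ((A - P * (1 - G * G)) *ᵥ y)) +
        (1 / 2) * (x ⬝ᵥ ((A - P * (1 - G * G)) *ᵥ x)) +
        (A *ᵥ m - P *ᵥ ((1 + G) *ᵥ g)) ⬝ᵥ (y - x) := by
  have symm : ∀ {M : Matrix (Fin d) (Fin d) ℝ}, Mᵀ = M → ∀ u v, u ⬝ᵥ (M *ᵥ v) = v ⬝ᵥ (M *ᵥ u) :=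
    fun {M} hM u v => by
      rw [dotProduct_mulVec, ← mulVec_transpose, hM, dotProduct_comm]
  have adj : ∀ u v, (G *ᵥ u) ⬝ᵥ (P *ᵥ v) = u ⬝ᵥ (P *ᵥ (G *ᵥ v)) := fun u v => by
    rw [mulVec_mulVec, hPG, ← mulVec_mulVec, dotProduct_mulVec u, vecMul_transpose]
  simp only [mulVec_add, mulVec_sub, sub_mulVec, add_mulVec, one_mulVec, ← mulVec_mulVec,
    dotProduct_add, dotProduct_sub, sub_dotProduct, add_dotProduct, adj]
  rw [symm hA m x, symm hA m y, symm hP g x, symm hP g y, symm hP g (G *ᵥ x),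
    symm hP g (G *ᵥ y), adj, adj, symm hP y (G *ᵥ x), adj, dotProduct_comm (A *ᵥ m) x,
    dotProduct_comm (A *ᵥ m) y, dotProduct_comm (P *ᵥ g) x, dotProduct_comm (P *ᵥ g) y,
    dotProduct_comm (P *ᵥ (G *ᵥ g)) x, dotProduct_comm (P *ᵥ (G *ᵥ g)) y]
  ring

theorem sqrt_det_div_pos {d : ℕ} {P : Matrix (Fin d) (Fin d) ℝ} (hP : P.PosDef) :
    0 < Real.sqrt (P.det / (2 * Real.pi) ^ d) :=
  Real.sqrt_pos.2 (div_pos hP.det_pos (by positivity))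

end AR1

namespace AR1

/-- For MH with Gaussian target `N(A⁻¹b, A⁻¹)` and convergent stochastic
AR(1) proposal with `GΣ` symmetric, the acceptance probability satisfies
`α(x,y) = min{1, exp(−½ yᵀ(A−𝒜)y + ½ xᵀ(A−𝒜)x + (b−β)ᵀ(y−x))}`, where
`𝒜 := (∑ Gˡ Σ (Gᵀ)ˡ)⁻¹` and `β := 𝒜(I−G)⁻¹g`. -/
theorem stmt_5 {d : ℕ} (A : Matrix (Fin d) (Fin d) ℝ) (b : Fin d → ℝ)
    (G S : Matrix (Fin d) (Fin d) ℝ) (g : Fin d → ℝ)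
    (hA : A.PosDef) (hS : S.PosDef)
    (hρ : spectralRadius ℂ (G.map Complex.ofReal) < 1)
    (hGS : (G * S)ᵀ = G * S) :
    ∀ x y : Fin d → ℝ,
      accept (gaussDensity (A⁻¹ *ᵥ b) A) (propDensity G g S) x y =
        min 1 (Real.exp
          (-(1 / 2) * (y ⬝ᵥ ((A - (∑' l : ℕ, G ^ l * S * (Gᵀ) ^ l)⁻¹) *ᵥ y)) +
            (1 / 2) * (x ⬝ᵥ ((A - (∑' l : ℕ, G ^ l * S * (Gᵀ) ^ l)⁻¹) *ᵥ x)) +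
            (b - (∑' l : ℕ, G ^ l * S * (Gᵀ) ^ l)⁻¹ *ᵥ ((1 - G)⁻¹ *ᵥ g)) ⬝ᵥ (y - x))) := by
  intro x y
  have hSdet : IsUnit S.det := (Matrix.isUnit_iff_isUnit_det _).1 hS.isUnit
  have hAdet : IsUnit A.det := (Matrix.isUnit_iff_isUnit_det _).1 hA.isUnit
  have hAt : Aᵀ = A := by simpa using hA.isHermitian.eq
  have hSt : Sᵀ = S := by simpa using hS.isHermitian.eq
  have hGS' : G * S = S * Gᵀ := by rw [← hGS, transpose_mul, hSt]
  have hPt : S⁻¹ᵀ = S⁻¹ := by rw [transpose_nonsing_inv, hSt]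
  have hPG : S⁻¹ * G = Gᵀ * S⁻¹ := by
    calc S⁻¹ * G = S⁻¹ * (G * S) * S⁻¹ := by
          rw [mul_assoc, mul_assoc, mul_nonsing_inv _ hSdet, mul_one]
      _ = Gᵀ * S⁻¹ := by rw [hGS', ← mul_assoc, nonsing_inv_mul _ hSdet, one_mul]
  have hfac : 1 - G * G = (1 + G) * (1 - G) := by noncomm_ring
  have hsub := (Matrix.isUnit_iff_isUnit_det _).1 (isUnit_one_sub_of_spectralRadius_lt_one hρ)
  have hprec : (∑' l : ℕ, G ^ l * S * (Gᵀ) ^ l)⁻¹ = S⁻¹ * (1 - G * G) := by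
    apply inv_eq_left_inv
    rw [mul_assoc, one_sub_mul_tsum_pow_mul_mul_pow_transpose hρ hGS', nonsing_inv_mul _ hSdet]
  have hβ : (S⁻¹ * (1 - G * G)) *ᵥ ((1 - G)⁻¹ *ᵥ g) = S⁻¹ *ᵥ ((1 + G) *ᵥ g) := by
    rw [mulVec_mulVec, mulVec_mulVec, hfac, mul_assoc, mul_assoc, mul_nonsing_inv _ hsub, mul_one]
  have hm : A *ᵥ (A⁻¹ *ᵥ b) = b := by
    rw [mulVec_mulVec, mul_nonsing_inv _ hAdet, one_mulVec]
  have hratio := gaussian_log_ratio (A⁻¹ *ᵥ b) g hAt hPt hPG x y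
  rw [hm] at hratio
  rw [hprec, hβ, ← hratio, Real.exp_sub, Real.exp_add, Real.exp_add]
  have hcA := (sqrt_det_div_pos hA).ne'
  have hcS := (sqrt_det_div_pos hS.inv).ne'
  simp only [accept, propDensity, gaussDensity]
  congr 1
  rw [mul_div_mul_comm, mul_div_mul_left _ _ hcA, mul_div_mul_left _ _ hcS, ← mul_div_mul_comm]

end AR1
end
end

section
/- For each dimension d, consider the Metropolis–Hastings algorithm with Gaussian target N(A^{-1}b, A^{-1}) and stochastic AR(1) proposal y = Gx + g + ν, ν ~ N(0,Σ), where G and Σ are functions of A and ρ(G) < 1, started in equilibrium x ~ N(A^{-1}b, A^{-1}). Suppose there exists δ > 0 such that for each j ∈ {1,2,3,4,5}, (∑_{i=1}^d |T_{ji}|^{2+δ})/(∑_{i=1}^d |T_{ji}|²)^{1+δ/2} → 0 as d → ∞, and that μ = lim_{d→∞} ∑_{i=1}^d (T_{0i}+T_{3i}+T_{4i}) and σ² = lim_{d→∞} ∑_{i=1}^d (T_{1i}²+T_{2i}²+2T_{3i}²+2T_{4i}²+T_{5i}²) exist. Then Z := log(π(y)q(y,x)/(π(x)q(x,y))) converges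 in distribution to N(μ,σ²) as d → ∞, and the expected acceptance probability satisfies E[α(x,y)] = E[min{1, e^Z}] → Φ(μ/σ) + e^{μ+σ²/2} Φ(−σ − μ/σ) as d → ∞, where Φ is the standard normal cumulative distribution function. -/
noncomputable section

open MeasureTheory Matrix Filter Topology

namespace AR1

open ProbabilityTheory

theorem norm_cexp_sub_taylor_two_le (θ : ℝ) :
    ‖Complex.exp (θ * Complex.I) - (1 + θ * Complex.I - (θ : ℂ) ^ 2 / 2)‖ ≤ 4 * |θ| ^ 3 := by
  rcases le_total |θ| 1 with h | h
  · have hn : ‖(θ * Complex.I : ℂ)‖ = |θ| := by simp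
    have := Complex.exp_bound (x := θ * Complex.I) (by rw [hn]; exact h) (n := 3) (by norm_num)
    rw [hn] at this
    have e : ∑ m ∈ Finset.range 3, (θ * Complex.I : ℂ) ^ m / (m.factorial : ℂ)
        = 1 + θ * Complex.I - (θ : ℂ) ^ 2 / 2 := by
      simp [Finset.sum_range_succ, Nat.factorial, mul_pow]
      ring
    rw [e] at this
    refine this.trans ?_
    have : 0 ≤ |θ| ^ 3 := by positivity
    norm_num [Nat.factorial]
    nlinarith
  · have h1 : ‖Complex.exp (θ * Complex.I)‖ = 1 := Complex.norm_exp_ofReal_mul_I θ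
    have h2 : ‖(1 + θ * Complex.I - (θ : ℂ) ^ 2 / 2 : ℂ)‖ ≤ 1 + |θ| + |θ| ^ 2 / 2 := by
      refine (norm_sub_le _ _).trans (add_le_add ((norm_add_le _ _).trans ?_) ?_) <;> simp
    refine (norm_sub_le _ _).trans ?_
    rw [h1]
    have h3 : |θ| ≤ |θ| ^ 3 := by nlinarith [mul_nonneg (abs_nonneg θ) (sub_nonneg.2 h)]
    have h4 : |θ| ^ 2 ≤ |θ| ^ 3 := by nlinarith [mul_nonneg (sq_nonneg |θ|) (sub_nonneg.2 h)]
    linarith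

theorem norm_prod_sub_prod_le {ι : Type*} (s : Finset ι) (a b : ι → ℂ)
    (ha : ∀ i ∈ s, ‖a i‖ ≤ 1) (hb : ∀ i ∈ s, ‖b i‖ ≤ 1) :
    ‖∏ i ∈ s, a i - ∏ i ∈ s, b i‖ ≤ ∑ i ∈ s, ‖a i - b i‖ := by
  classical
  induction s using Finset.induction_on with
  | empty => simp
  | insert i s hi ih =>
    rw [Finset.prod_insert hi, Finset.prod_insert hi, Finset.sum_insert hi]
    have ih' := ih (fun j hj => ha j (Finset.mem_insert_of_mem hj))
      (fun j hj => hb j (Finset.mem_insert_of_mem hj))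
    have e : a i * ∏ j ∈ s, a j - b i * ∏ j ∈ s, b j
        = (a i - b i) * ∏ j ∈ s, a j + b i * (∏ j ∈ s, a j - ∏ j ∈ s, b j) := by ring
    rw [e]
    have h1 : ‖∏ j ∈ s, a j‖ ≤ 1 := by
      rw [norm_prod]
      exact Finset.prod_le_one (fun _ _ => norm_nonneg _)
        fun j hj => ha j (Finset.mem_insert_of_mem hj)
    refine (norm_add_le _ _).trans (add_le_add ?_ ?_) <;> rw [norm_mul]
    · exact mul_le_of_le_one_right (norm_nonneg _) h1
    · exact (mul_le_of_le_one_left (norm_nonneg _) (hb i (Finset.mem_insert_self _ _))).trans ih'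

theorem integrable_pow_gaussianReal (n : ℕ) :
    Integrable (fun x : ℝ => x ^ n) (gaussianReal 0 1) := by
  refine (memLp_id_gaussianReal' (μ := 0) (v := 1) n (by simp)).integrable_norm_pow' |>.mono'
    (by fun_prop) (ae_of_all _ fun x => by simp)

theorem integral_pow_gaussianReal (n : ℕ) :
    ∫ x : ℝ, x ^ n ∂(gaussianReal 0 1)
      = iteratedDeriv n (fun t : ℝ => Real.exp (t ^ 2 / 2)) 0 := by
  have h := iteratedDeriv_mgf_zero (X := id) (μ := gaussianReal 0 1)
    (by simp [integrableExpSet_id_gaussianReal]) n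
  rw [mgf_id_gaussianReal] at h
  simpa using h.symm

theorem iteratedDeriv_exp_sq_half (t : ℝ) :
    iteratedDeriv 1 (fun t : ℝ => Real.exp (t ^ 2 / 2)) t = t * Real.exp (t ^ 2 / 2) ∧
    iteratedDeriv 2 (fun t : ℝ => Real.exp (t ^ 2 / 2)) t = (t ^ 2 + 1) * Real.exp (t ^ 2 / 2) ∧
    iteratedDeriv 3 (fun t : ℝ => Real.exp (t ^ 2 / 2)) t
      = (t ^ 3 + 3 * t) * Real.exp (t ^ 2 / 2) ∧
    iteratedDeriv 4 (fun t : ℝ => Real.exp (t ^ 2 / 2)) t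
      = (t ^ 4 + 6 * t ^ 2 + 3) * Real.exp (t ^ 2 / 2) := by
  have h0 (t : ℝ) : HasDerivAt (fun t : ℝ => Real.exp (t ^ 2 / 2))
      (Real.exp (t ^ 2 / 2) * t) t := by
    have := (((hasDerivAt_id t).pow 2).div_const 2).exp
    simpa using this
  have h1 : iteratedDeriv 1 (fun t : ℝ => Real.exp (t ^ 2 / 2))
      = fun t => t * Real.exp (t ^ 2 / 2) := by
    ext t
    rw [iteratedDeriv_one, (h0 t).deriv]
    ring
  have h2 : iteratedDeriv 2 (fun t : ℝ => Real.exp (t ^ 2 / 2))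
      = fun t => (t ^ 2 + 1) * Real.exp (t ^ 2 / 2) := by
    ext t
    rw [iteratedDeriv_succ, h1, ((hasDerivAt_id' t).fun_mul (h0 t)).deriv]
    ring
  have h3 : iteratedDeriv 3 (fun t : ℝ => Real.exp (t ^ 2 / 2))
      = fun t => (t ^ 3 + 3 * t) * Real.exp (t ^ 2 / 2) := by
    ext t
    rw [iteratedDeriv_succ, h2, (((hasDerivAt_pow 2 t).add_const 1).fun_mul (h0 t)).deriv]
    push_cast
    ring
  refine ⟨congrFun h1 t, congrFun h2 t, congrFun h3 t, ?_⟩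
  rw [iteratedDeriv_succ, h3,
    (((hasDerivAt_pow 3 t).fun_add ((hasDerivAt_id' t).const_mul 3)).fun_mul (h0 t)).deriv]
  push_cast
  simp
  ring

/-- Expectation of a quartic polynomial under the standard Gaussian measure. -/
theorem integral_quartic_gaussianReal (a b c d e : ℝ) :
    ∫ x : ℝ, (a + b * x + c * x ^ 2 + d * x ^ 3 + e * x ^ 4) ∂(gaussianReal 0 1)
      = a + c + 3 * e := by
  have i1 : Integrable (fun x : ℝ => x) (gaussianReal 0 1) := by
    simpa using integrable_pow_gaussianReal 1
  have i2 := integrable_pow_gaussianReal 2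
  have i3 := integrable_pow_gaussianReal 3
  have i4 := integrable_pow_gaussianReal 4
  have m1 : ∫ x : ℝ, x ∂(gaussianReal 0 1) = 0 := by simp
  have m2 := integral_pow_gaussianReal 2
  have m3 := integral_pow_gaussianReal 3
  have m4 := integral_pow_gaussianReal 4
  rw [(iteratedDeriv_exp_sq_half 0).2.1] at m2
  rw [(iteratedDeriv_exp_sq_half 0).2.2.1] at m3
  rw [(iteratedDeriv_exp_sq_half 0).2.2.2] at m4
  have j1 : Integrable (fun x : ℝ => a + b * x) (gaussianReal 0 1) :=
    (integrable_const a).add (i1.const_mul b)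
  have j2 : Integrable (fun x : ℝ => a + b * x + c * x ^ 2) (gaussianReal 0 1) :=
    j1.add (i2.const_mul c)
  have j3 : Integrable (fun x : ℝ => a + b * x + c * x ^ 2 + d * x ^ 3) (gaussianReal 0 1) :=
    j2.add (i3.const_mul d)
  rw [integral_add j3 (i4.const_mul e), integral_add j2 (i3.const_mul d),
    integral_add j1 (i2.const_mul c), integral_add (integrable_const a) (i1.const_mul b)]
  rw [integral_const_mul, integral_const_mul, integral_const_mul, integral_const_mul,
    m1, m2, m3, m4]
  simp
  ring

/-- The product of two standard Gaussian measures on `ℝ`. -/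
def stdGaussianPair : Measure (ℝ × ℝ) := (gaussianReal 0 1).prod (gaussianReal 0 1)

instance : IsProbabilityMeasure stdGaussianPair := by
  unfold stdGaussianPair
  infer_instance

/-- The centred quadratic polynomial in two variables with coefficients `c 1, …, c 5`. -/
def centredQuadratic (c : ℕ → ℝ) (p : ℝ × ℝ) : ℝ :=
  c 1 * p.1 + c 2 * p.2 + c 3 * (p.1 ^ 2 - 1) + c 4 * (p.2 ^ 2 - 1) + c 5 * p.1 * p.2

/-- The variance of `centredQuadratic c` under `stdGaussianPair`. -/
def quadraticVariance (c : ℕ → ℝ) : ℝ :=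
  c 1 ^ 2 + c 2 ^ 2 + 2 * c 3 ^ 2 + 2 * c 4 ^ 2 + c 5 ^ 2

/-- The `ℓ¹` size of the coefficients `c 1, …, c 5`. -/
def coeffSize (c : ℕ → ℝ) : ℝ := |c 1| + |c 2| + |c 3| + |c 4| + |c 5|

/-- A polynomial weight dominating every `centredQuadratic` polynomial. -/
def quadraticWeight (p : ℝ × ℝ) : ℝ := (1 + p.1 ^ 2) * (1 + p.2 ^ 2)

theorem coeffSize_nonneg (c : ℕ → ℝ) : 0 ≤ coeffSize c := by
  unfold coeffSize
  positivity

theorem one_le_quadraticWeight (p : ℝ × ℝ) : 1 ≤ quadraticWeight p := by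
  unfold quadraticWeight
  nlinarith [sq_nonneg p.1, sq_nonneg p.2, mul_nonneg (sq_nonneg p.1) (sq_nonneg p.2)]

theorem quadraticVariance_nonneg (c : ℕ → ℝ) : 0 ≤ quadraticVariance c := by
  unfold quadraticVariance
  positivity

theorem quadraticVariance_le (c : ℕ → ℝ) : quadraticVariance c ≤ 2 * coeffSize c ^ 2 := by
  unfold quadraticVariance coeffSize
  rw [← sq_abs (c 1), ← sq_abs (c 2), ← sq_abs (c 3), ← sq_abs (c 4), ← sq_abs (c 5)]
  have h1 := abs_nonneg (c 1)
  have h2 := abs_nonneg (c 2)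
  have h3 := abs_nonneg (c 3)
  have h4 := abs_nonneg (c 4)
  have h5 := abs_nonneg (c 5)
  generalize |c 1| = a at *
  generalize |c 2| = b at *
  generalize |c 3| = d at *
  generalize |c 4| = e at *
  generalize |c 5| = f at *
  have : 0 ≤ a ^ 2 + b ^ 2 + f ^ 2 + 4 * (a * b + a * d + a * e + a * f + b * d + b * e + b * f
    + d * e + d * f + e * f) := by positivity
  nlinarith

theorem coeffSize_sq_le (c : ℕ → ℝ) : coeffSize c ^ 2 ≤ 5 * quadraticVariance c := by
  unfold quadraticVariance coeffSize
  have h := sq_sum_le_card_mul_sum_sq (s := Finset.range 5) (f := fun j => |c (j + 1)|)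
  simp only [Finset.sum_range_succ, Finset.sum_range_zero, sq_abs, Finset.card_range] at h
  norm_num at h
  nlinarith [sq_nonneg (c 3), sq_nonneg (c 4)]

theorem continuous_centredQuadratic (c : ℕ → ℝ) : Continuous (centredQuadratic c) := by
  unfold centredQuadratic
  fun_prop

theorem abs_centredQuadratic_le (c : ℕ → ℝ) (p : ℝ × ℝ) :
    |centredQuadratic c p| ≤ coeffSize c * quadraticWeight p := by
  have hx := sq_nonneg p.1
  have hy := sq_nonneg p.2
  have hxy := mul_nonneg hx hy
  have b1 : |p.1| ≤ quadraticWeight p := by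
    unfold quadraticWeight
    rw [abs_le]
    constructor <;> nlinarith [sq_nonneg (p.1 - 1), sq_nonneg (p.1 + 1)]
  have b2 : |p.2| ≤ quadraticWeight p := by
    unfold quadraticWeight
    rw [abs_le]
    constructor <;> nlinarith [sq_nonneg (p.2 - 1), sq_nonneg (p.2 + 1)]
  have b3 : |p.1 ^ 2 - 1| ≤ quadraticWeight p := by
    unfold quadraticWeight
    rw [abs_le]
    constructor <;> nlinarith
  have b4 : |p.2 ^ 2 - 1| ≤ quadraticWeight p := by
    unfold quadraticWeight
    rw [abs_le]
    constructor <;> nlinarith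
  have b5 : |p.1 * p.2| ≤ quadraticWeight p := by
    unfold quadraticWeight
    rw [abs_le]
    constructor <;> nlinarith [sq_nonneg (p.1 - p.2), sq_nonneg (p.1 + p.2)]
  have key : |centredQuadratic c p| ≤ |c 1| * |p.1| + |c 2| * |p.2| + |c 3| * |p.1 ^ 2 - 1|
      + |c 4| * |p.2 ^ 2 - 1| + |c 5| * |p.1 * p.2| := by
    unfold centredQuadratic
    rw [← abs_mul, ← abs_mul, ← abs_mul, ← abs_mul, ← abs_mul, mul_assoc (c 5)]
    refine (abs_add_le _ _).trans (add_le_add_left ?_ _)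
    refine (abs_add_le _ _).trans (add_le_add_left ?_ _)
    refine (abs_add_le _ _).trans (add_le_add_left ?_ _)
    exact abs_add_le _ _
  refine key.trans ?_
  unfold coeffSize
  rw [add_mul, add_mul, add_mul, add_mul]
  gcongr

theorem integrable_quadraticWeight_pow_three :
    Integrable (fun p => quadraticWeight p ^ 3) stdGaussianPair := by
  have h : Integrable (fun x : ℝ => (1 + x ^ 2) ^ 3) (gaussianReal 0 1) := by
    have e : (fun x : ℝ => (1 + x ^ 2) ^ 3) = fun x => 1 + 3 * x ^ 2 + 3 * x ^ 4 + x ^ 6 := by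
      ext x
      ring
    rw [e]
    exact (((integrable_const 1).add ((integrable_pow_gaussianReal 2).const_mul 3)).add
      ((integrable_pow_gaussianReal 4).const_mul 3)).add (integrable_pow_gaussianReal 6)
  refine (h.mul_prod h).congr (ae_of_all _ fun p => ?_)
  simp only [quadraticWeight, mul_pow]

theorem abs_centredQuadratic_pow_le (c : ℕ → ℝ) (p : ℝ × ℝ) {n : ℕ} (hn : n ≤ 3) :
    |centredQuadratic c p| ^ n ≤ coeffSize c ^ n * quadraticWeight p ^ 3 := by
  calc |centredQuadratic c p| ^ n ≤ (coeffSize c * quadraticWeight p) ^ n :=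
        pow_le_pow_left₀ (abs_nonneg _) (abs_centredQuadratic_le c p) n
    _ = coeffSize c ^ n * quadraticWeight p ^ n := mul_pow _ _ _
    _ ≤ _ := mul_le_mul_of_nonneg_left (pow_le_pow_right₀ (one_le_quadraticWeight p) hn)
        (pow_nonneg (coeffSize_nonneg c) n)

theorem integrable_centredQuadratic_pow (c : ℕ → ℝ) {n : ℕ} (hn : n ≤ 3) :
    Integrable (fun p => centredQuadratic c p ^ n) stdGaussianPair := by
  refine (integrable_quadraticWeight_pow_three.const_mul (coeffSize c ^ n)).mono'
    ((continuous_centredQuadratic c).pow n).aestronglyMeasurable (ae_of_all _ fun p => ?_)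
  rw [norm_pow, Real.norm_eq_abs]
  exact abs_centredQuadratic_pow_le c p hn

theorem integral_centredQuadratic (c : ℕ → ℝ) :
    ∫ p, centredQuadratic c p ∂stdGaussianPair = 0 := by
  have hi : Integrable (centredQuadratic c) stdGaussianPair := by
    simpa using integrable_centredQuadratic_pow c (n := 1) (by norm_num)
  unfold stdGaussianPair at *
  rw [integral_prod _ hi]
  have inner (x : ℝ) : ∫ y, centredQuadratic c (x, y) ∂(gaussianReal 0 1)
      = -c 3 + c 1 * x + c 3 * x ^ 2 + 0 * x ^ 3 + 0 * x ^ 4 := by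
    have e (y : ℝ) : centredQuadratic c (x, y) = (c 1 * x + c 3 * (x ^ 2 - 1) - c 4)
        + (c 2 + c 5 * x) * y + c 4 * y ^ 2 + 0 * y ^ 3 + 0 * y ^ 4 := by
      simp only [centredQuadratic]
      ring
    simp_rw [e]
    rw [integral_quartic_gaussianReal]
    ring
  simp_rw [inner]
  rw [integral_quartic_gaussianReal]
  ring

theorem integral_centredQuadratic_sq (c : ℕ → ℝ) :
    ∫ p, centredQuadratic c p ^ 2 ∂stdGaussianPair = quadraticVariance c := by
  have hi := integrable_centredQuadratic_pow c (n := 2) (by norm_num)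
  unfold stdGaussianPair at *
  rw [integral_prod _ hi]
  have inner (x : ℝ) : ∫ y, centredQuadratic c (x, y) ^ 2 ∂(gaussianReal 0 1)
      = (c 3 ^ 2 + c 2 ^ 2 + 2 * c 4 ^ 2) + (2 * c 2 * c 5 - 2 * c 1 * c 3) * x
        + (c 1 ^ 2 - 2 * c 3 ^ 2 + c 5 ^ 2) * x ^ 2 + 2 * c 1 * c 3 * x ^ 3
        + c 3 ^ 2 * x ^ 4 := by
    have e (y : ℝ) : centredQuadratic c (x, y) ^ 2
        = (c 1 * x + c 3 * (x ^ 2 - 1) - c 4) ^ 2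
        + 2 * (c 1 * x + c 3 * (x ^ 2 - 1) - c 4) * (c 2 + c 5 * x) * y
        + ((c 2 + c 5 * x) ^ 2 + 2 * (c 1 * x + c 3 * (x ^ 2 - 1) - c 4) * c 4) * y ^ 2
        + 2 * (c 2 + c 5 * x) * c 4 * y ^ 3 + c 4 ^ 2 * y ^ 4 := by
      simp only [centredQuadratic]
      ring
    simp_rw [e]
    rw [integral_quartic_gaussianReal]
    ring
  simp_rw [inner]
  rw [integral_quartic_gaussianReal]
  unfold quadraticVariance
  ring

theorem norm_integral_cexp_centredQuadratic_sub_taylor_le (c : ℕ → ℝ) (t : ℝ) :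
    ‖∫ p, Complex.exp ((t * centredQuadratic c p : ℝ) * Complex.I) ∂stdGaussianPair
        - ((1 - t ^ 2 * quadraticVariance c / 2 : ℝ) : ℂ)‖
      ≤ 4 * |t| ^ 3 * (∫ p, quadraticWeight p ^ 3 ∂stdGaussianPair) * coeffSize c ^ 3 := by
  have i1 : Integrable (fun p => (centredQuadratic c p : ℂ)) stdGaussianPair := by
    simpa using (integrable_centredQuadratic_pow c (n := 1) (by norm_num)).ofReal (𝕜 := ℂ)
  have i2 : Integrable (fun p => ((centredQuadratic c p ^ 2 : ℝ) : ℂ)) stdGaussianPair :=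
    (integrable_centredQuadratic_pow c (n := 2) (by norm_num)).ofReal
  have hq := continuous_centredQuadratic c
  have ie : Integrable (fun p => Complex.exp ((t * centredQuadratic c p : ℝ) * Complex.I))
      stdGaussianPair := by
    refine (integrable_const (1 : ℝ)).mono' (by fun_prop) (ae_of_all _ fun p => ?_)
    rw [Complex.norm_exp_ofReal_mul_I]
  have it : Integrable (fun p => (1 + (t * centredQuadratic c p : ℝ) * Complex.I
      - ((t * centredQuadratic c p : ℝ) : ℂ) ^ 2 / 2 : ℂ)) stdGaussianPair := by
    refine (((integrable_const (1 : ℂ)).add (i1.const_mul (t * Complex.I))).sub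
      (i2.const_mul ((t : ℂ) ^ 2 / 2))).congr (ae_of_all _ fun p => ?_)
    simp
    ring
  have et : ∫ p, (1 + (t * centredQuadratic c p : ℝ) * Complex.I
      - ((t * centredQuadratic c p : ℝ) : ℂ) ^ 2 / 2 : ℂ) ∂stdGaussianPair
      = ((1 - t ^ 2 * quadraticVariance c / 2 : ℝ) : ℂ) := by
    have e : ∀ p, (1 + (t * centredQuadratic c p : ℝ) * Complex.I
      - ((t * centredQuadratic c p : ℝ) : ℂ) ^ 2 / 2 : ℂ) = 1 + (t * Complex.I)
        * (centredQuadratic c p : ℂ) - ((t : ℂ) ^ 2 / 2) * ((centredQuadratic c p ^ 2 : ℝ) : ℂ) := by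
      intro p
      push_cast
      ring
    simp_rw [e]
    have i3 : Integrable (fun p => 1 + (t * Complex.I) * (centredQuadratic c p : ℂ))
        stdGaussianPair := (integrable_const (1 : ℂ)).add (i1.const_mul (t * Complex.I))
    rw [integral_sub i3 (i2.const_mul ((t : ℂ) ^ 2 / 2)), integral_add (integrable_const (1 : ℂ))
      (i1.const_mul (t * Complex.I)), integral_const_mul, integral_const_mul,
      integral_complex_ofReal, integral_complex_ofReal, integral_centredQuadratic,
      integral_centredQuadratic_sq]
    simp
    ring
  rw [← et, ← integral_sub ie it]
  refine (norm_integral_le_of_norm_le (integrable_quadraticWeight_pow_three.const_mul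
    (4 * |t| ^ 3 * coeffSize c ^ 3)) (ae_of_all _ fun p => ?_)).trans_eq ?_
  · refine (norm_cexp_sub_taylor_two_le _).trans ?_
    rw [abs_mul, mul_pow]
    have := abs_centredQuadratic_pow_le c p le_rfl
    have ht : 0 ≤ 4 * |t| ^ 3 := by positivity
    nlinarith [mul_le_mul_of_nonneg_left this ht]
  · rw [integral_const_mul]
    ring

theorem abs_exp_neg_sub_one_sub_le {y : ℝ} (hy : 0 ≤ y) :
    |Real.exp (-y) - (1 - y)| ≤ y ^ 2 := by
  rcases le_total y 1 with h | h
  · have := Real.abs_exp_sub_one_sub_id_le (x := -y) (by rwa [abs_neg, abs_of_nonneg hy])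
    rw [neg_sq] at this
    convert this using 2
    ring
  · have h1 := Real.add_one_le_exp (-y)
    have h2 : Real.exp (-y) ≤ 1 := Real.exp_le_one_iff.2 (by linarith)
    rw [abs_le]
    constructor <;> nlinarith

theorem norm_integral_cexp_centredQuadratic_sub_gaussian_le (t : ℝ) :
    ∃ K : ℝ, 0 ≤ K ∧ ∀ c : ℕ → ℝ, coeffSize c ≤ 1 →
      ‖∫ p, Complex.exp ((t * centredQuadratic c p : ℝ) * Complex.I) ∂stdGaussianPair
        - Complex.exp ((-(t ^ 2 * quadraticVariance c / 2) : ℝ) : ℂ)‖ ≤ K * coeffSize c ^ 3 := by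
  have hI : 0 ≤ ∫ p, quadraticWeight p ^ 3 ∂stdGaussianPair :=
    integral_nonneg fun p => pow_nonneg (zero_le_one.trans (one_le_quadraticWeight p)) 3
  refine ⟨4 * |t| ^ 3 * (∫ p, quadraticWeight p ^ 3 ∂stdGaussianPair) + t ^ 4, by positivity,
    fun c hc => ?_⟩
  have h1 := norm_integral_cexp_centredQuadratic_sub_taylor_le c t
  have hv := quadraticVariance_nonneg c
  have hs := coeffSize_nonneg c
  have h2 : ‖((1 - t ^ 2 * quadraticVariance c / 2 : ℝ) : ℂ)
      - Complex.exp ((-(t ^ 2 * quadraticVariance c / 2) : ℝ) : ℂ)‖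
      ≤ t ^ 4 * coeffSize c ^ 3 := by
    rw [norm_sub_rev, ← Complex.ofReal_exp, ← Complex.ofReal_sub, Complex.norm_real,
      Real.norm_eq_abs]
    have hy : 0 ≤ t ^ 2 * quadraticVariance c / 2 := by positivity
    refine (abs_exp_neg_sub_one_sub_le hy).trans ?_
    have hle : t ^ 2 * quadraticVariance c / 2 ≤ t ^ 2 * coeffSize c ^ 2 := by
      have := mul_le_mul_of_nonneg_left (quadraticVariance_le c) (sq_nonneg t)
      linarith
    calc (t ^ 2 * quadraticVariance c / 2) ^ 2 ≤ (t ^ 2 * coeffSize c ^ 2) ^ 2 :=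
          pow_le_pow_left₀ hy hle 2
      _ = t ^ 4 * coeffSize c ^ 4 := by ring
      _ ≤ _ := mul_le_mul_of_nonneg_left (pow_le_pow_of_le_one hs hc (by norm_num))
          (by positivity)
  refine (norm_sub_le_norm_sub_add_norm_sub _ _ _).trans ((add_le_add h1 h2).trans_eq ?_)
  ring

theorem tendsto_sum_rpow_of_ratio {δ : ℝ} (hδ : 0 < δ) (T : (d : ℕ) → Fin d → ℝ)
    (hT : Tendsto (fun d : ℕ =>
        (∑ i, |T d i| ^ ((2 : ℝ) + δ)) / (∑ i, |T d i| ^ 2) ^ ((1 : ℝ) + δ / 2)) atTop (𝓝 0))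
    {C : ℝ} (hC : ∀ᶠ d in atTop, ∑ i, T d i ^ 2 ≤ C) :
    Tendsto (fun d : ℕ => ∑ i, |T d i| ^ ((2 : ℝ) + δ)) atTop (𝓝 0) := by
  have h := hT.mul_const (C ^ ((1 : ℝ) + δ / 2))
  rw [zero_mul] at h
  refine squeeze_zero' (Eventually.of_forall fun d => ?_) ?_ h
  · exact Finset.sum_nonneg fun i _ => Real.rpow_nonneg (abs_nonneg _) _
  · filter_upwards [hC] with d hd
    have hN : 0 ≤ ∑ i, |T d i| ^ ((2 : ℝ) + δ) :=
      Finset.sum_nonneg fun i _ => Real.rpow_nonneg (abs_nonneg _) _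
    have hs : 0 ≤ ∑ i, |T d i| ^ 2 := Finset.sum_nonneg fun i _ => sq_nonneg _
    rcases hs.eq_or_lt with h0 | h0
    · have hz := (Finset.sum_eq_zero_iff_of_nonneg fun i _ => sq_nonneg |T d i|).1 h0.symm
      have : ∑ i, |T d i| ^ ((2 : ℝ) + δ) = 0 := by
        refine Finset.sum_eq_zero fun i hi => ?_
        rw [pow_eq_zero_iff (two_ne_zero) |>.1 (hz i hi), Real.zero_rpow (by positivity)]
      rw [this, zero_div, zero_mul]
    · have hD : 0 < (∑ i, |T d i| ^ 2) ^ ((1 : ℝ) + δ / 2) := Real.rpow_pos_of_pos h0 _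
      calc ∑ i, |T d i| ^ ((2 : ℝ) + δ)
          = (∑ i, |T d i| ^ ((2 : ℝ) + δ)) / (∑ i, |T d i| ^ 2) ^ ((1 : ℝ) + δ / 2)
            * (∑ i, |T d i| ^ 2) ^ ((1 : ℝ) + δ / 2) := (div_mul_cancel₀ _ hD.ne').symm
        _ ≤ _ := by
          refine mul_le_mul_of_nonneg_left (Real.rpow_le_rpow hs ?_ (by positivity))
            (div_nonneg hN hD.le)
          simpa only [sq_abs] using hd

theorem eventually_abs_le_of_tendsto_sum_rpow {q : ℝ} (hq : 0 < q) (T : (d : ℕ) → Fin d → ℝ)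
    (hT : Tendsto (fun d : ℕ => ∑ i, |T d i| ^ q) atTop (𝓝 0)) {ε : ℝ} (hε : 0 < ε) :
    ∀ᶠ d in atTop, ∀ i, |T d i| ≤ ε := by
  filter_upwards [hT.eventually_lt_const (Real.rpow_pos_of_pos hε q)] with d hd i
  refine le_of_not_gt fun hlt => ?_
  have h1 : |T d i| ^ q ≤ ∑ i, |T d i| ^ q :=
    Finset.single_le_sum (f := fun i => |T d i| ^ q)
      (fun i _ => Real.rpow_nonneg (abs_nonneg _) _) (Finset.mem_univ i)
  exact absurd (Real.rpow_lt_rpow hε.le hlt hq) (not_lt.2 (h1.trans hd.le))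

theorem sq_le_quadraticVariance (c : ℕ → ℝ) {j : ℕ} (hj : j ∈ Finset.Icc 1 5) :
    c j ^ 2 ≤ quadraticVariance c := by
  unfold quadraticVariance
  have h (k : ℕ) := sq_nonneg (c k)
  rw [Finset.mem_Icc] at hj
  obtain ⟨h1, h5⟩ := hj
  interval_cases j <;> linarith [h 1, h 2, h 3, h 4, h 5]

theorem eventually_coeffSize_le {δ : ℝ} (hδ : 0 < δ) (T : ℕ → (d : ℕ) → Fin d → ℝ)
    (hLyap : ∀ j ∈ Finset.Icc 1 5, Tendsto (fun d : ℕ =>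
        (∑ i, |T j d i| ^ ((2 : ℝ) + δ)) / (∑ i, |T j d i| ^ 2) ^ ((1 : ℝ) + δ / 2))
      atTop (𝓝 0))
    {C : ℝ} (hC : ∀ᶠ d in atTop, ∑ i, quadraticVariance (fun j => T j d i) ≤ C)
    {ε : ℝ} (hε : 0 < ε) :
    ∀ᶠ d in atTop, ∀ i, coeffSize (fun j => T j d i) ≤ ε := by
  have h (j : ℕ) (hj : j ∈ Finset.Icc 1 5) : ∀ᶠ d in atTop, ∀ i, |T j d i| ≤ ε / 5 := by
    refine eventually_abs_le_of_tendsto_sum_rpow (q := 2 + δ) (by positivity) (T j)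
      (tendsto_sum_rpow_of_ratio hδ (T j) (hLyap j hj) (C := C) ?_) (by positivity)
    filter_upwards [hC] with d hd
    exact (Finset.sum_le_sum fun i _ =>
      sq_le_quadraticVariance (fun j => T j d i) hj).trans hd
  filter_upwards [h 1 (by decide), h 2 (by decide), h 3 (by decide), h 4 (by decide),
    h 5 (by decide)] with d h1 h2 h3 h4 h5 i
  unfold coeffSize
  linarith [h1 i, h2 i, h3 i, h4 i, h5 i]

/-- Lyapunov central limit theorem, at the level of characteristic functions, for row-wise
independent arrays of quadratic polynomials in Gaussian pairs. -/
theorem tendsto_prod_integral_cexp_centredQuadratic {δ : ℝ} (hδ : 0 < δ)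
    (T : ℕ → (d : ℕ) → Fin d → ℝ)
    (hLyap : ∀ j ∈ Finset.Icc 1 5, Tendsto (fun d : ℕ =>
        (∑ i, |T j d i| ^ ((2 : ℝ) + δ)) / (∑ i, |T j d i| ^ 2) ^ ((1 : ℝ) + δ / 2))
      atTop (𝓝 0))
    {σ2 : ℝ} (hσ : Tendsto (fun d : ℕ => ∑ i, quadraticVariance (fun j => T j d i))
      atTop (𝓝 σ2)) (t : ℝ) :
    Tendsto (fun d : ℕ => ∏ i, ∫ p, Complex.exp
        ((t * centredQuadratic (fun j => T j d i) p : ℝ) * Complex.I) ∂stdGaussianPair)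
      atTop (𝓝 (Complex.exp ((-(t ^ 2 * σ2 / 2) : ℝ) : ℂ))) := by
  have hb : ∀ᶠ d in atTop, ∑ i, quadraticVariance (fun j => T j d i) ≤ σ2 + 1 :=
    (hσ.eventually_lt_const (lt_add_one σ2)).mono fun _ h => h.le
  obtain ⟨K, hK0, hK⟩ := norm_integral_cexp_centredQuadratic_sub_gaussian_le t
  have hlim : Tendsto (fun d : ℕ => ∏ i, Complex.exp
      ((-(t ^ 2 * quadraticVariance (fun j => T j d i) / 2) : ℝ) : ℂ))
      atTop (𝓝 (Complex.exp ((-(t ^ 2 * σ2 / 2) : ℝ) : ℂ))) := by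
    have e (d : ℕ) : ∏ i, Complex.exp
        ((-(t ^ 2 * quadraticVariance (fun j => T j d i) / 2) : ℝ) : ℂ)
        = Complex.exp ((-(t ^ 2 * (∑ i, quadraticVariance (fun j => T j d i)) / 2) : ℝ) : ℂ) := by
      rw [← Complex.exp_sum, ← Complex.ofReal_sum, Finset.sum_neg_distrib, Finset.mul_sum,
        Finset.sum_div]
    simp_rw [e]
    refine (Complex.continuous_exp.tendsto _).comp
      ((Complex.continuous_ofReal.tendsto _).comp ?_)
    exact ((hσ.const_mul (t ^ 2)).div_const 2).neg
  have hdiff : Tendsto (fun d : ℕ => (∏ i, ∫ p, Complex.exp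
        ((t * centredQuadratic (fun j => T j d i) p : ℝ) * Complex.I) ∂stdGaussianPair)
      - ∏ i, Complex.exp ((-(t ^ 2 * quadraticVariance (fun j => T j d i) / 2) : ℝ) : ℂ))
      atTop (𝓝 0) := by
    rw [NormedAddGroup.tendsto_nhds_zero]
    intro ε hε
    have hσ0 : 0 ≤ σ2 := ge_of_tendsto' hσ fun d =>
      Finset.sum_nonneg fun i _ => quadraticVariance_nonneg _
    set η : ℝ := min 1 (ε / (2 * (K * (5 * (σ2 + 1)) + 1))) with hη
    have hden : 0 < K * (5 * (σ2 + 1)) + 1 := by positivity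
    have hη0 : 0 < η := lt_min one_pos (by positivity)
    filter_upwards [hb, eventually_coeffSize_le hδ T hLyap hb hη0] with d hd hsmall
    refine (norm_prod_sub_prod_le _ _ _ (fun i _ => ?_) (fun i _ => ?_)).trans_lt ?_
    · refine (norm_integral_le_of_norm_le_const (C := 1) (ae_of_all _ fun p => ?_)).trans_eq ?_
      · rw [Complex.norm_exp_ofReal_mul_I]
      · simp
    · rw [← Complex.ofReal_exp, Complex.norm_real, Real.norm_eq_abs, Real.abs_exp,
        Real.exp_le_one_iff]
      have := quadraticVariance_nonneg (fun j => T j d i)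
      rw [neg_nonpos]
      positivity
    calc _ ≤ ∑ i, K * (η * (5 * quadraticVariance (fun j => T j d i))) := by
          refine Finset.sum_le_sum fun i _ =>
            (hK _ ((hsmall i).trans (min_le_left _ _))).trans ?_
          refine mul_le_mul_of_nonneg_left ?_ hK0
          calc coeffSize (fun j => T j d i) ^ 3
              = coeffSize (fun j => T j d i) * coeffSize (fun j => T j d i) ^ 2 := by ring
            _ ≤ _ := mul_le_mul (hsmall i) (coeffSize_sq_le _) (sq_nonneg _) hη0.le
      _ = K * 5 * η * ∑ i, quadraticVariance (fun j => T j d i) := by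
          rw [Finset.mul_sum]
          exact Finset.sum_congr rfl fun i _ => by ring
      _ ≤ K * 5 * η * (σ2 + 1) := mul_le_mul_of_nonneg_left hd (by positivity)
      _ = η * (K * (5 * (σ2 + 1))) := by ring
      _ ≤ η * (K * (5 * (σ2 + 1)) + 1) := mul_le_mul_of_nonneg_left (by linarith) hη0.le
      _ ≤ ε / (2 * (K * (5 * (σ2 + 1)) + 1)) * (K * (5 * (σ2 + 1)) + 1) :=
          mul_le_mul_of_nonneg_right (min_le_right _ _) hden.le
      _ = ε / 2 := by field_simp
      _ < ε := by linarith
  simpa using hdiff.add hlim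

/-- The logarithm of the one-dimensional Metropolis–Hastings ratio for the target with mean `m`
and precision `l` and the proposal `N(a x + (1 - a) n, s)`. -/
def pairLogRatio (l m a n s : ℝ) (p : ℝ × ℝ) : ℝ :=
  Real.log (gaussianPDFReal m (l⁻¹).toNNReal p.2
      * gaussianPDFReal (a * p.2 + (1 - a) * n) s.toNNReal p.1
    / (gaussianPDFReal m (l⁻¹).toNNReal p.1
      * gaussianPDFReal (a * p.1 + (1 - a) * n) s.toNNReal p.2))

/-- The joint density of a one-dimensional state and its proposal. -/
def pairDensity (l m a n s : ℝ) (p : ℝ × ℝ) : ℝ :=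
  gaussianPDFReal m (l⁻¹).toNNReal p.1 * gaussianPDFReal (a * p.1 + (1 - a) * n) s.toNNReal p.2

theorem pairLogRatio_eq {l s : ℝ} (hl : 0 < l) (hs : 0 < s) (m a n : ℝ) (p : ℝ × ℝ) :
    pairLogRatio l m a n s p = -(p.2 - m) ^ 2 * l / 2 + (p.1 - m) ^ 2 * l / 2
      - (p.1 - (a * p.2 + (1 - a) * n)) ^ 2 / (2 * s)
      + (p.2 - (a * p.1 + (1 - a) * n)) ^ 2 / (2 * s) := by
  have hc : (Real.sqrt (2 * Real.pi * l⁻¹))⁻¹ ≠ 0 := by positivity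
  have hc' : (Real.sqrt (2 * Real.pi * s))⁻¹ ≠ 0 := by positivity
  simp only [pairLogRatio, gaussianPDFReal, Real.coe_toNNReal _ (inv_pos.2 hl).le,
    Real.coe_toNNReal _ hs.le]
  rw [Real.log_div (by positivity) (by positivity), Real.log_mul (by positivity) (by positivity),
    Real.log_mul (by positivity) (by positivity), Real.log_mul (by positivity) (by positivity),
    Real.log_mul (by positivity) (by positivity), Real.log_mul (by positivity) (by positivity),
    Real.log_mul (by positivity) (by positivity)]
  simp only [Real.log_exp]
  field_simp
  ring

theorem continuous_pairLogRatio {l s : ℝ} (hl : 0 < l) (hs : 0 < s) (m a n : ℝ) :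
    Continuous (pairLogRatio l m a n s) := by
  have : pairLogRatio l m a n s = _ := funext (pairLogRatio_eq hl hs m a n)
  rw [this]
  fun_prop

/-- The affine map sending a standard Gaussian pair to a stationary state and its proposal. -/
def stateProposal (l m a n s : ℝ) (p : ℝ × ℝ) : ℝ × ℝ :=
  (m + Real.sqrt l⁻¹ * p.1, a * (m + Real.sqrt l⁻¹ * p.1) + (1 - a) * n + Real.sqrt s * p.2)

theorem pairLogRatio_stateProposal {l s a : ℝ} (hl : 0 < l) (hs : 0 < s) (ha : |a| < 1)
    (m n : ℝ) (c : ℕ → ℝ) {k : ℝ} (hk : k = (1 - a ^ 2) / s)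
    (h0 : c 0 = (m - n) ^ 2 * l * ((1 / 2) * ((l - k) / l) * (1 - a ^ 2) - (1 - a)))
    (h1 : c 1 = (m - n) * Real.sqrt l * (((l - k) / l) * (1 - a ^ 2) - (1 - a)))
    (h2 : c 2 = (m - n) * Real.sqrt l * Real.sqrt ((l / k) * (1 - a ^ 2)) *
      (1 - ((l - k) / l) * a))
    (h3 : c 3 = (1 / 2) * ((l - k) / l) * (1 - a ^ 2))
    (h4 : c 4 = -(1 / 2) * ((l - k) / l) * (l / k) * (1 - a ^ 2))
    (h5 : c 5 = -((l - k) / l) * a * Real.sqrt ((l / k) * (1 - a ^ 2))) (p : ℝ × ℝ) :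
    pairLogRatio l m a n s (stateProposal l m a n s p)
      = (c 0 + c 3 + c 4) + centredQuadratic c p := by
  have ha' : 0 < 1 - a ^ 2 := by nlinarith [abs_lt.1 ha, (sq_lt_one_iff_abs_lt_one a).2 ha]
  have e1 : (l / k) * (1 - a ^ 2) = l * s := by
    rw [hk]
    field_simp
  rw [e1, Real.sqrt_mul hl.le] at h2 h5
  rw [mul_assoc _ (l / k), e1] at h4
  rw [pairLogRatio_eq hl hs]
  simp only [stateProposal, centredQuadratic]
  rw [h0, h1, h2, h3, h4, h5, hk, Real.sqrt_inv]
  obtain ⟨x, hx, rfl⟩ : ∃ x, 0 < x ∧ l = x ^ 2 :=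
    ⟨Real.sqrt l, Real.sqrt_pos.2 hl, (Real.sq_sqrt hl.le).symm⟩
  obtain ⟨y, hy, rfl⟩ : ∃ y, 0 < y ∧ s = y ^ 2 :=
    ⟨Real.sqrt s, Real.sqrt_pos.2 hs, (Real.sq_sqrt hs.le).symm⟩
  rw [Real.sqrt_sq hx.le, Real.sqrt_sq hy.le]
  field_simp
  ring

theorem gaussianReal_eq_map_affine (m : ℝ) {v : ℝ} (hv : 0 ≤ v) :
    gaussianReal m v.toNNReal = (gaussianReal 0 1).map (fun x => m + Real.sqrt v * x) := by
  have h : (fun x => m + Real.sqrt v * x) = (fun y => m + y) ∘ (fun x => Real.sqrt v * x) := rfl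
  rw [h, ← Measure.map_map (by fun_prop) (by fun_prop), gaussianReal_map_const_mul,
    gaussianReal_map_const_add]
  congr 1
  · simp
  · ext
    simp [Real.sq_sqrt hv, hv]

theorem integral_gaussianPDFReal_smul (m : ℝ) {v : ℝ} (hv : 0 < v) {F : ℝ → ℂ}
    (hF : Measurable F) :
    ∫ x, gaussianPDFReal m v.toNNReal x • F x
      = ∫ x, F (m + Real.sqrt v * x) ∂(gaussianReal 0 1) := by
  rw [← integral_gaussianReal_eq_integral_smul (by simpa using hv),
    gaussianReal_eq_map_affine m hv.le, integral_map (by fun_prop) hF.aestronglyMeasurable]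

theorem continuous_pairDensity (l m a n s : ℝ) : Continuous (pairDensity l m a n s) := by
  unfold pairDensity
  simp only [gaussianPDFReal]
  fun_prop

theorem pairDensity_nonneg (l m a n s : ℝ) (p : ℝ × ℝ) : 0 ≤ pairDensity l m a n s p :=
  mul_nonneg (gaussianPDFReal_nonneg _ _ _) (gaussianPDFReal_nonneg _ _ _)

theorem integrable_pairDensity {s : ℝ} (hs : 0 < s) (l m a n : ℝ) :
    Integrable (pairDensity l m a n s) := by
  rw [Measure.volume_eq_prod, integrable_prod_iff
    (continuous_pairDensity l m a n s).aestronglyMeasurable]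
  constructor
  · refine ae_of_all _ fun x => ?_
    simp only [pairDensity]
    exact (integrable_gaussianPDFReal _ _).const_mul _
  · refine (integrable_gaussianPDFReal m (l⁻¹).toNNReal).congr (ae_of_all _ fun x => ?_)
    simp only [Real.norm_of_nonneg (pairDensity_nonneg _ _ _ _ _ _)]
    simp only [pairDensity, integral_const_mul]
    rw [integral_gaussianPDFReal_eq_one _ (by simpa using hs), mul_one]

theorem integral_pairDensity_smul {l s : ℝ} (hl : 0 < l) (hs : 0 < s) (m a n : ℝ)
    {F : ℝ × ℝ → ℂ} (hF : Measurable F) (hF1 : ∀ p, ‖F p‖ ≤ 1) :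
    ∫ p, pairDensity l m a n s p • F p
      = ∫ p, F (stateProposal l m a n s p) ∂stdGaussianPair := by
  have hint : Integrable (fun p => pairDensity l m a n s p • F p) := by
    refine (integrable_pairDensity hs l m a n).mono'
      ((continuous_pairDensity l m a n s).measurable.smul hF).aestronglyMeasurable
      (ae_of_all _ fun p => ?_)
    rw [norm_smul, Real.norm_of_nonneg (pairDensity_nonneg _ _ _ _ _ _)]
    exact mul_le_of_le_one_right (pairDensity_nonneg _ _ _ _ _ _) (hF1 p)
  have hmeas : Measurable (stateProposal l m a n s) := by
    unfold stateProposal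
    fun_prop
  have hint' : Integrable (fun p => F (stateProposal l m a n s p))
      ((gaussianReal 0 1).prod (gaussianReal 0 1)) :=
    (integrable_const (1 : ℝ)).mono' (hF.comp hmeas).aestronglyMeasurable
      (ae_of_all _ fun p => hF1 _)
  have hinner (x : ℝ) : ∫ y, pairDensity l m a n s (x, y) • F (x, y)
      = gaussianPDFReal m (l⁻¹).toNNReal x •
        ∫ y, F (x, a * x + (1 - a) * n + Real.sqrt s * y) ∂(gaussianReal 0 1) := by
    rw [← integral_gaussianPDFReal_smul _ hs (F := fun y => F (x, y)) (by fun_prop),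
      ← integral_smul]
    simp only [pairDensity, mul_smul]
  have houter : Measurable (fun x => ∫ y, F (x, a * x + (1 - a) * n + Real.sqrt s * y)
      ∂(gaussianReal 0 1)) := by
    refine (StronglyMeasurable.integral_prod_right (f := fun x y =>
      F (x, a * x + (1 - a) * n + Real.sqrt s * y)) ?_).measurable
    exact (by fun_prop : Measurable _).stronglyMeasurable
  rw [Measure.volume_eq_prod] at hint ⊢
  rw [integral_prod _ hint, stdGaussianPair, integral_prod _ hint']
  simp_rw [hinner]
  rw [integral_gaussianPDFReal_smul m (inv_pos.2 hl) houter]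
  rfl

section Rotation

variable {d : ℕ} {Q : Matrix (Fin d) (Fin d) ℝ}

theorem transpose_mulVec_mulVec_of_orthogonal (hQ : Qᵀ * Q = 1) (u : Fin d → ℝ) :
    Qᵀ *ᵥ (Q *ᵥ u) = u := by
  rw [mulVec_mulVec, hQ, one_mulVec]

theorem mulVec_transpose_mulVec_of_orthogonal (hQ : Qᵀ * Q = 1) (u : Fin d → ℝ) :
    Q *ᵥ (Qᵀ *ᵥ u) = u := by
  rw [mulVec_mulVec, mul_eq_one_comm.1 hQ, one_mulVec]

theorem conj_diagonal_mulVec_mulVec (hQ : Qᵀ * Q = 1) (p u : Fin d → ℝ) :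
    (Q * diagonal p * Qᵀ) *ᵥ (Q *ᵥ u) = Q *ᵥ fun i => p i * u i := by
  rw [← mulVec_mulVec, transpose_mulVec_mulVec_of_orthogonal hQ, ← mulVec_mulVec]
  congr 1
  ext i
  rw [mulVec_diagonal]

theorem inv_conj_diagonal (hQ : Qᵀ * Q = 1) {p : Fin d → ℝ} (hp : ∀ i, p i ≠ 0) :
    (Q * diagonal p * Qᵀ)⁻¹ = Q * diagonal (fun i => (p i)⁻¹) * Qᵀ := by
  refine inv_eq_right_inv ?_
  have h : diagonal p * diagonal (fun i => (p i)⁻¹) = 1 := by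
    rw [diagonal_mul_diagonal, ← diagonal_one]
    congr 1
    ext i
    exact mul_inv_cancel₀ (hp i)
  calc Q * diagonal p * Qᵀ * (Q * diagonal (fun i => (p i)⁻¹) * Qᵀ)
      = Q * diagonal p * (Qᵀ * Q) * diagonal (fun i => (p i)⁻¹) * Qᵀ := by
        simp only [Matrix.mul_assoc]
    _ = Q * (diagonal p * diagonal (fun i => (p i)⁻¹)) * Qᵀ := by
        rw [hQ, Matrix.mul_one, Matrix.mul_assoc Q]
    _ = 1 := by rw [h, Matrix.mul_one, mul_eq_one_comm.1 hQ]

theorem det_conj_diagonal (hQ : Qᵀ * Q = 1) (p : Fin d → ℝ) :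
    (Q * diagonal p * Qᵀ).det = ∏ i, p i := by
  have h : Qᵀ.det * Q.det = 1 := by rw [← det_mul, hQ, det_one]
  rw [det_mul, det_mul, det_diagonal, mul_right_comm, mul_comm Q.det, h, one_mul]

theorem mulVec_dotProduct_mulVec_of_orthogonal (hQ : Qᵀ * Q = 1) (u v : Fin d → ℝ) :
    (Q *ᵥ u) ⬝ᵥ (Q *ᵥ v) = u ⬝ᵥ v := by
  rw [dotProduct_mulVec, vecMul_mulVec, hQ, vecMul_one]

theorem gaussDensity_conj_diagonal (hQ : Qᵀ * Q = 1) {p : Fin d → ℝ} (hp : ∀ i, 0 < p i)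
    (m u : Fin d → ℝ) :
    gaussDensity m (Q * diagonal p * Qᵀ) (Q *ᵥ u)
      = ∏ i, gaussianPDFReal ((Qᵀ *ᵥ m) i) ((p i)⁻¹).toNNReal (u i) := by
  have hsub : Q *ᵥ u - m = Q *ᵥ (u - Qᵀ *ᵥ m) := by
    rw [mulVec_sub, mulVec_transpose_mulVec_of_orthogonal hQ]
  have hc : Real.sqrt ((∏ i, p i) / (2 * Real.pi) ^ d)
      = ∏ i, (Real.sqrt (2 * Real.pi * (p i)⁻¹))⁻¹ := by
    have e : (∏ i, p i) / (2 * Real.pi) ^ d = ∏ i, (2 * Real.pi * (p i)⁻¹)⁻¹ := by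
      rw [Finset.prod_congr rfl fun i _ => show (2 * Real.pi * (p i)⁻¹)⁻¹ = p i / (2 * Real.pi) by
        rw [mul_inv, inv_inv, div_eq_mul_inv, mul_comm], Finset.prod_div_distrib]
      simp
    have hpos (i : Fin d) : 0 ≤ (2 * Real.pi * (p i)⁻¹)⁻¹ := by
      have := hp i
      positivity
    rw [e, Real.sqrt_prod _ fun i _ => hpos i]
    exact Finset.prod_congr rfl fun i _ => Real.sqrt_inv _
  have hv (i : Fin d) : (((p i)⁻¹).toNNReal : ℝ) = (p i)⁻¹ :=
    Real.coe_toNNReal _ (inv_pos.2 (hp i)).le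
  unfold gaussDensity
  rw [hsub, conj_diagonal_mulVec_mulVec hQ, mulVec_dotProduct_mulVec_of_orthogonal hQ,
    det_conj_diagonal hQ, hc]
  simp only [gaussianPDFReal, hv]
  rw [Finset.prod_mul_distrib, ← Real.exp_sum, dotProduct, Finset.mul_sum]
  congr 2
  refine Finset.sum_congr rfl fun i _ => ?_
  have := (hp i).ne'
  simp only [Pi.sub_apply]
  field_simp

theorem propDensity_conj_diagonal (hQ : Qᵀ * Q = 1) {G S : Matrix (Fin d) (Fin d) ℝ}
    {a s n g : Fin d → ℝ} (hG : G = Q * diagonal a * Qᵀ) (hS : S = Q * diagonal s * Qᵀ)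
    (hs : ∀ i, 0 < s i) (hg : ∀ i, (Qᵀ *ᵥ g) i = (1 - a i) * n i) (u v : Fin d → ℝ) :
    propDensity G g S (Q *ᵥ u) (Q *ᵥ v)
      = ∏ i, gaussianPDFReal (a i * u i + (1 - a i) * n i) (s i).toNNReal (v i) := by
  unfold propDensity
  rw [hS, inv_conj_diagonal hQ fun i => (hs i).ne',
    gaussDensity_conj_diagonal hQ fun i => inv_pos.2 (hs i)]
  refine Finset.prod_congr rfl fun i _ => ?_
  rw [inv_inv, hG, conj_diagonal_mulVec_mulVec hQ, mulVec_add,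
    transpose_mulVec_mulVec_of_orthogonal hQ, Pi.add_apply, hg]

theorem transpose_mulVec_eq_of_eq_inv_mulVec (hQ : Qᵀ * Q = 1) {G : Matrix (Fin d) (Fin d) ℝ}
    {a n g : Fin d → ℝ} (hG : G = Q * diagonal a * Qᵀ) (ha : ∀ i, |a i| < 1)
    (hn : n = Qᵀ *ᵥ ((1 - G)⁻¹ *ᵥ g)) (i : Fin d) :
    (Qᵀ *ᵥ g) i = (1 - a i) * n i := by
  have h1 : 1 - G = Q * diagonal (fun i => 1 - a i) * Qᵀ := by
    have : diagonal (fun i => 1 - a i) = 1 - diagonal a := by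
      rw [← diagonal_one, diagonal_sub]
    rw [this, Matrix.mul_sub, Matrix.sub_mul, Matrix.mul_one, mul_eq_one_comm.1 hQ, hG]
  have h2 (i : Fin d) : 1 - a i ≠ 0 := by linarith [(abs_lt.1 (ha i)).2]
  rw [hn, h1, inv_conj_diagonal hQ h2]
  nth_rw 2 [← mulVec_transpose_mulVec_of_orthogonal hQ g]
  rw [conj_diagonal_mulVec_mulVec hQ, transpose_mulVec_mulVec_of_orthogonal hQ,
    mul_inv_cancel_left₀ (h2 i)]

/-- The map sending coordinates of a pair of vectors in the eigenbasis `Q` to the pair. -/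
def rotatePair (Q : Matrix (Fin d) (Fin d) ℝ) (w : Fin d → ℝ × ℝ) :
    (Fin d → ℝ) × (Fin d → ℝ) :=
  (Q *ᵥ fun i => (w i).1, Q *ᵥ fun i => (w i).2)

theorem measurePreserving_mulVec_of_orthogonal (hQ : Qᵀ * Q = 1) :
    MeasurePreserving (fun u : Fin d → ℝ => Q *ᵥ u) := by
  have hdet : Q.det * Q.det = 1 := by
    have := congrArg det hQ
    rwa [det_mul, det_transpose, det_one] at this
  have habs : |Q.det| = 1 := by
    rcases mul_self_eq_one_iff.1 hdet with h | h <;> simp [h]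
  refine ⟨(Continuous.matrix_mulVec continuous_const continuous_id).measurable, ?_⟩
  have h := Real.map_matrix_volume_pi_eq_smul_volume_pi (M := Q)
    (fun h0 => by simp [h0] at hdet)
  rw [abs_inv, habs, inv_one, ENNReal.ofReal_one, one_smul] at h
  exact h

theorem measurePreserving_rotatePair (hQ : Qᵀ * Q = 1) : MeasurePreserving (rotatePair Q) := by
  have h := measurePreserving_mulVec_of_orthogonal hQ
  exact (h.prod h).comp (volume_measurePreserving_arrowProdEquivProdArrow ℝ ℝ (Fin d))

theorem continuous_gaussDensity {X : Type*} [TopologicalSpace X] (P : Matrix (Fin d) (Fin d) ℝ)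
    {m x : X → Fin d → ℝ} (hm : Continuous m) (hx : Continuous x) :
    Continuous fun z => gaussDensity (m z) P (x z) := by
  unfold gaussDensity
  have h := hx.sub hm
  exact continuous_const.mul (Real.continuous_exp.comp
    (continuous_const.mul (h.dotProduct (continuous_const.matrix_mulVec h))))

theorem continuous_propDensity {X : Type*} [TopologicalSpace X]
    (G S : Matrix (Fin d) (Fin d) ℝ) (g : Fin d → ℝ)
    {x y : X → Fin d → ℝ} (hx : Continuous x) (hy : Continuous y) :
    Continuous fun z => propDensity G g S (x z) (y z) :=
  continuous_gaussDensity _ ((continuous_const.matrix_mulVec hx).add continuous_const) hy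

theorem gaussDensity_nonneg (m : Fin d → ℝ) (P : Matrix (Fin d) (Fin d) ℝ) (x : Fin d → ℝ) :
    0 ≤ gaussDensity m P x := by
  unfold gaussDensity
  positivity

theorem measurable_logRatio (m g : Fin d → ℝ) (P G S : Matrix (Fin d) (Fin d) ℝ) :
    Measurable (logRatio (gaussDensity m P) (propDensity G g S)) := by
  unfold logRatio
  have h1 := continuous_gaussDensity P (continuous_const (y := m))
    (continuous_fst (X := Fin d → ℝ) (Y := Fin d → ℝ))
  have h2 := continuous_gaussDensity P (continuous_const (y := m))
    (continuous_snd (X := Fin d → ℝ) (Y := Fin d → ℝ))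
  have h3 := continuous_propDensity G S g (continuous_fst (X := Fin d → ℝ) (Y := Fin d → ℝ))
    continuous_snd
  have h4 := continuous_propDensity G S g (continuous_snd (X := Fin d → ℝ) (Y := Fin d → ℝ))
    continuous_fst
  exact Real.measurable_log.comp ((h2.mul h4).measurable.div (h1.mul h3).measurable)

theorem integral_jointMeasure (m g : Fin d → ℝ) (P G S : Matrix (Fin d) (Fin d) ℝ)
    (F : (Fin d → ℝ) × (Fin d → ℝ) → ℂ) :
    ∫ z, F z ∂(jointMeasure (gaussDensity m P) (propDensity G g S))
      = ∫ z, (gaussDensity m P z.1 * propDensity G g S z.1 z.2) • F z := by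
  have hc : Continuous fun z : (Fin d → ℝ) × (Fin d → ℝ) =>
      gaussDensity m P z.1 * propDensity G g S z.1 z.2 :=
    (continuous_gaussDensity P continuous_const continuous_fst).mul
      (continuous_propDensity G S g continuous_fst continuous_snd)
  unfold jointMeasure
  rw [integral_withDensity_eq_integral_toReal_smul hc.measurable.ennreal_ofReal
    (ae_of_all _ fun _ => ENNReal.ofReal_lt_top)]
  refine integral_congr_ae (ae_of_all _ fun z => ?_)
  simp only
  rw [ENNReal.toReal_ofReal]
  exact mul_nonneg (gaussDensity_nonneg _ _ _) (gaussDensity_nonneg _ _ _)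

variable {A G S : Matrix (Fin d) (Fin d) ℝ} {l a s m n b g : Fin d → ℝ}

theorem density_rotatePair (hQ : Qᵀ * Q = 1) (hA : A = Q * diagonal l * Qᵀ)
    (hG : G = Q * diagonal a * Qᵀ) (hS : S = Q * diagonal s * Qᵀ)
    (hl : ∀ i, 0 < l i) (hs : ∀ i, 0 < s i)
    (hm : m = Qᵀ *ᵥ b) (hg : ∀ i, (Qᵀ *ᵥ g) i = (1 - a i) * n i) (w : Fin d → ℝ × ℝ) :
    gaussDensity b A (rotatePair Q w).1
        * propDensity G g S (rotatePair Q w).1 (rotatePair Q w).2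
      = ∏ i, pairDensity (l i) (m i) (a i) (n i) (s i) (w i) := by
  simp only [rotatePair, pairDensity]
  rw [propDensity_conj_diagonal hQ hG hS hs hg, hA, gaussDensity_conj_diagonal hQ hl,
    ← Finset.prod_mul_distrib, hm]

theorem logRatio_rotatePair (hQ : Qᵀ * Q = 1) (hA : A = Q * diagonal l * Qᵀ)
    (hG : G = Q * diagonal a * Qᵀ) (hS : S = Q * diagonal s * Qᵀ)
    (hl : ∀ i, 0 < l i) (hs : ∀ i, 0 < s i)
    (hm : m = Qᵀ *ᵥ b) (hg : ∀ i, (Qᵀ *ᵥ g) i = (1 - a i) * n i) (w : Fin d → ℝ × ℝ) :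
    logRatio (gaussDensity b A) (propDensity G g S) (rotatePair Q w)
      = ∑ i, pairLogRatio (l i) (m i) (a i) (n i) (s i) (w i) := by
  simp only [logRatio, rotatePair, pairLogRatio]
  rw [propDensity_conj_diagonal hQ hG hS hs hg, propDensity_conj_diagonal hQ hG hS hs hg, hA,
    gaussDensity_conj_diagonal hQ hl, gaussDensity_conj_diagonal hQ hl,
    ← Finset.prod_mul_distrib, ← Finset.prod_mul_distrib, ← Finset.prod_div_distrib, hm]
  refine Real.log_prod fun i _ => ?_
  have h1 (x y : ℝ) : gaussianPDFReal y ((l i)⁻¹).toNNReal x ≠ 0 :=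
    (gaussianPDFReal_pos _ _ _ (by simpa using hl i)).ne'
  have h2 (x y : ℝ) : gaussianPDFReal y (s i).toNNReal x ≠ 0 :=
    (gaussianPDFReal_pos _ _ _ (by simpa using hs i)).ne'
  exact div_ne_zero (mul_ne_zero (h1 _ _) (h2 _ _)) (mul_ne_zero (h1 _ _) (h2 _ _))

theorem integral_cexp_logRatio (hQ : Qᵀ * Q = 1) (hA : A = Q * diagonal l * Qᵀ)
    (hG : G = Q * diagonal a * Qᵀ) (hS : S = Q * diagonal s * Qᵀ)
    (hl : ∀ i, 0 < l i) (hs : ∀ i, 0 < s i)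
    (hm : m = Qᵀ *ᵥ b) (hg : ∀ i, (Qᵀ *ᵥ g) i = (1 - a i) * n i) (t : ℝ) :
    ∫ z, Complex.exp ((t * logRatio (gaussDensity b A) (propDensity G g S) z : ℝ) * Complex.I)
        ∂(jointMeasure (gaussDensity b A) (propDensity G g S))
      = ∏ i, ∫ p, Complex.exp ((t * pairLogRatio (l i) (m i) (a i) (n i) (s i)
          (stateProposal (l i) (m i) (a i) (n i) (s i) p) : ℝ) * Complex.I) ∂stdGaussianPair := by
  have hmp := measurePreserving_rotatePair hQ
  have hmeas := measurable_logRatio b g A G S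
  have hd : Continuous fun z : (Fin d → ℝ) × (Fin d → ℝ) =>
      gaussDensity b A z.1 * propDensity G g S z.1 z.2 :=
    (continuous_gaussDensity A continuous_const continuous_fst).mul
      (continuous_propDensity G S g continuous_fst continuous_snd)
  have hF : Measurable fun z => Complex.exp
      ((t * logRatio (gaussDensity b A) (propDensity G g S) z : ℝ) * Complex.I) := by
    fun_prop
  have hsm : AEStronglyMeasurable (fun z => (gaussDensity b A z.1 * propDensity G g S z.1 z.2) •
      Complex.exp ((t * logRatio (gaussDensity b A) (propDensity G g S) z : ℝ) * Complex.I))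
      (Measure.map (rotatePair Q) volume) :=
    (hd.measurable.smul hF).aestronglyMeasurable
  rw [integral_jointMeasure, ← hmp.map_eq, integral_map hmp.measurable.aemeasurable hsm]
  simp_rw [density_rotatePair hQ hA hG hS hl hs hm hg, logRatio_rotatePair hQ hA hG hS hl hs hm hg]
  have e (w : Fin d → ℝ × ℝ) :
      (∏ i, pairDensity (l i) (m i) (a i) (n i) (s i) (w i)) • Complex.exp
        ((t * ∑ i, pairLogRatio (l i) (m i) (a i) (n i) (s i) (w i) : ℝ) * Complex.I)
      = ∏ i, pairDensity (l i) (m i) (a i) (n i) (s i) (w i) • Complex.exp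
        ((t * pairLogRatio (l i) (m i) (a i) (n i) (s i) (w i) : ℝ) * Complex.I) := by
    simp only [Complex.real_smul]
    rw [Finset.prod_mul_distrib, ← Complex.exp_sum, ← Finset.sum_mul, Complex.ofReal_prod,
      Finset.mul_sum, Complex.ofReal_sum]
  simp_rw [e]
  rw [integral_fintype_prod_volume_eq_prod (fun i p =>
    pairDensity (l i) (m i) (a i) (n i) (s i) p • Complex.exp
        ((t * pairLogRatio (l i) (m i) (a i) (n i) (s i) p : ℝ) * Complex.I))]
  refine Finset.prod_congr rfl fun i _ => ?_
  have hc := continuous_pairLogRatio (hl i) (hs i) (m i) (a i) (n i)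
  refine integral_pairDensity_smul (hl i) (hs i) _ _ _ (by fun_prop) fun p => ?_
  rw [Complex.norm_exp_ofReal_mul_I]

theorem isProbabilityMeasure_jointMeasure (hQ : Qᵀ * Q = 1) (hA : A = Q * diagonal l * Qᵀ)
    (hG : G = Q * diagonal a * Qᵀ) (hS : S = Q * diagonal s * Qᵀ)
    (hl : ∀ i, 0 < l i) (hs : ∀ i, 0 < s i)
    (hm : m = Qᵀ *ᵥ b) (hg : ∀ i, (Qᵀ *ᵥ g) i = (1 - a i) * n i) :
    IsProbabilityMeasure (jointMeasure (gaussDensity b A) (propDensity G g S)) := by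
  have h := integral_cexp_logRatio hQ hA hG hS hl hs hm hg 0
  simp only [zero_mul, Complex.ofReal_zero, Complex.exp_zero, integral_const, probReal_univ,
    one_smul, Finset.prod_const_one, Complex.real_smul, mul_one] at h
  have h' : (jointMeasure (gaussDensity b A) (propDensity G g S)).real Set.univ = 1 := by
    exact_mod_cast h
  refine ⟨?_⟩
  rw [Measure.real] at h'
  exact (ENNReal.toReal_eq_one_iff _).1 h'

end Rotation

/-- The mean of the log acceptance ratio in one direction is dominated by its variance, as soon as
the coefficients are bounded. -/
theorem abs_drift_le {l s a : ℝ} (hl : 0 < l) (hs : 0 < s) (ha : |a| < 1)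
    (m n : ℝ) (c : ℕ → ℝ) {k : ℝ} (hk : k = (1 - a ^ 2) / s)
    (h0 : c 0 = (m - n) ^ 2 * l * ((1 / 2) * ((l - k) / l) * (1 - a ^ 2) - (1 - a)))
    (h1 : c 1 = (m - n) * Real.sqrt l * (((l - k) / l) * (1 - a ^ 2) - (1 - a)))
    (h2 : c 2 = (m - n) * Real.sqrt l * Real.sqrt ((l / k) * (1 - a ^ 2)) *
      (1 - ((l - k) / l) * a))
    (h3 : c 3 = (1 / 2) * ((l - k) / l) * (1 - a ^ 2))
    (h4 : c 4 = -(1 / 2) * ((l - k) / l) * (l / k) * (1 - a ^ 2))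
    (h5 : c 5 = -((l - k) / l) * a * Real.sqrt ((l / k) * (1 - a ^ 2)))
    (hc : coeffSize c ≤ 1) :
    |c 0 + c 3 + c 4| ≤ 3 * quadraticVariance c := by
  have ha' : 0 < 1 - a ^ 2 := by nlinarith [abs_lt.1 ha, (sq_lt_one_iff_abs_lt_one a).2 ha]
  have e1 : (l / k) * (1 - a ^ 2) = l * s := by
    rw [hk]
    field_simp
  rw [e1, Real.sqrt_mul hl.le] at h2 h5
  rw [mul_assoc _ (l / k), e1] at h4
  have key : c 3 + c 4 = -(1 / 2) * (c 5 ^ 2 - 4 * c 3 * c 4) ∧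
      c 0 = -(1 / 2) * (c 1 ^ 2 * (1 - 2 * c 4) + 2 * c 5 * c 1 * c 2
        + c 2 ^ 2 * (1 - 2 * c 3)) := by
    rw [h0, h1, h2, h3, h4, h5, hk]
    obtain ⟨x, hx, rfl⟩ : ∃ x, 0 < x ∧ l = x ^ 2 :=
      ⟨Real.sqrt l, Real.sqrt_pos.2 hl, (Real.sq_sqrt hl.le).symm⟩
    obtain ⟨y, hy, rfl⟩ : ∃ y, 0 < y ∧ s = y ^ 2 :=
      ⟨Real.sqrt s, Real.sqrt_pos.2 hs, (Real.sq_sqrt hs.le).symm⟩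
    rw [Real.sqrt_sq hx.le, Real.sqrt_sq hy.le]
    constructor
    · field_simp
      ring
    · field_simp
      ring
  obtain ⟨k1, k2⟩ := key
  have e : c 0 + c 3 + c 4 = -(1 / 2) * (c 1 ^ 2 * (1 - 2 * c 4) + 2 * c 5 * c 1 * c 2
        + c 2 ^ 2 * (1 - 2 * c 3)) + -(1 / 2) * (c 5 ^ 2 - 4 * c 3 * c 4) := by
    rw [← k1, ← k2]
    ring
  unfold coeffSize at hc
  have b3 : |c 3| ≤ 1 := by
    linarith [abs_nonneg (c 1), abs_nonneg (c 2), abs_nonneg (c 4), abs_nonneg (c 5)]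
  have b4 : |c 4| ≤ 1 := by
    linarith [abs_nonneg (c 1), abs_nonneg (c 2), abs_nonneg (c 3), abs_nonneg (c 5)]
  have b5 : |c 5| ≤ 1 := by
    linarith [abs_nonneg (c 1), abs_nonneg (c 2), abs_nonneg (c 3), abs_nonneg (c 4)]
  rw [abs_le] at b3 b4 b5
  have hp : |2 * (c 5 * (c 1 * c 2))| ≤ c 1 ^ 2 + c 2 ^ 2 := by
    rw [abs_le]
    constructor
    · linarith [mul_nonneg (sub_nonneg.2 b5.2) (sq_nonneg (c 1 - c 2)),
        mul_nonneg (neg_le_iff_add_nonneg.1 b5.1) (sq_nonneg (c 1 + c 2))]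
    · linarith [mul_nonneg (sub_nonneg.2 b5.2) (sq_nonneg (c 1 + c 2)),
        mul_nonneg (neg_le_iff_add_nonneg.1 b5.1) (sq_nonneg (c 1 - c 2))]
  rw [abs_le] at hp
  have q1 := mul_nonneg (sub_nonneg.2 b4.2) (sq_nonneg (c 1))
  have q2 := mul_nonneg (neg_le_iff_add_nonneg.1 b4.1) (sq_nonneg (c 1))
  have q3 := mul_nonneg (sub_nonneg.2 b3.2) (sq_nonneg (c 2))
  have q4 := mul_nonneg (neg_le_iff_add_nonneg.1 b3.1) (sq_nonneg (c 2))
  unfold quadraticVariance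
  rw [e, abs_le]
  constructor <;>
  linarith [sq_nonneg (c 3 - c 4), sq_nonneg (c 3 + c 4), sq_nonneg (c 5), sq_nonneg (c 1),
    sq_nonneg (c 2), hp.1, hp.2]

theorem stdNormalCDF_eq (z : ℝ) : stdNormalCDF z = (gaussianReal 0 1).real (Set.Iic z) := rfl

theorem integral_min_one_exp_gaussianReal (m : ℝ) {s : ℝ} (hs : 0 < s) :
    ∫ z, min 1 (Real.exp z) ∂(gaussianReal m (s ^ 2).toNNReal) = acceptLimit m s := by
  set γ := gaussianReal m (s ^ 2).toNNReal with hγ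
  have hv : (s ^ 2).toNNReal ≠ 0 := by simpa using hs.ne'
  have hint : Integrable (fun z => min 1 (Real.exp z)) γ := by
    refine (integrable_const (1 : ℝ)).mono' (by fun_prop) (ae_of_all _ fun z => ?_)
    rw [Real.norm_of_nonneg (le_min zero_le_one (Real.exp_pos z).le)]
    exact min_le_left _ _
  have hshift (z : ℝ) : gaussianPDFReal m (s ^ 2).toNNReal z * Real.exp z
      = Real.exp (m + s ^ 2 / 2) * gaussianPDFReal (m + s ^ 2) (s ^ 2).toNNReal z := by
    simp only [gaussianPDFReal, Real.coe_toNNReal _ (sq_nonneg s)]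
    rw [mul_assoc, ← Real.exp_add, mul_left_comm, ← Real.exp_add]
    congr 2
    field_simp
    ring
  have hIic (a : ℝ) : (gaussianReal a (s ^ 2).toNNReal).real (Set.Iic 0) =
      stdNormalCDF (-a / s) := by
    rw [gaussianReal_eq_map_affine a (sq_nonneg s), Real.sqrt_sq hs.le,
      map_measureReal_apply (by fun_prop) measurableSet_Iic, stdNormalCDF_eq]
    congr 1
    ext x
    simp only [Set.mem_preimage, Set.mem_Iic]
    rw [le_div_iff₀ hs]
    constructor <;> intro h <;> nlinarith
  have hIoi : γ.real (Set.Ioi 0) = stdNormalCDF (m / s) := by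
    have h : gaussianReal (-m) (s ^ 2).toNNReal = γ.map (fun x => -x) :=
      gaussianReal_map_neg.symm
    have h1 := hIic (-m)
    rw [h, map_measureReal_apply (by fun_prop) measurableSet_Iic, neg_neg] at h1
    rw [← h1, Set.neg_preimage, Set.neg_Iic, neg_zero]
    have : NullSingletonClass γ := nullSingletonClass_gaussianReal hv
    exact measureReal_congr Ioi_ae_eq_Ici
  rw [← integral_add_compl measurableSet_Iic hint (s := Set.Iic 0), Set.compl_Iic,
    setIntegral_congr_fun (g := fun _ => (1 : ℝ)) measurableSet_Ioi fun z hz =>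
      min_eq_left (Real.one_le_exp (le_of_lt hz)),
    setIntegral_congr_fun (g := Real.exp) measurableSet_Iic fun z hz =>
      min_eq_right (Real.exp_le_one_iff.2 hz), setIntegral_const, hIoi]
  have hneg : ∫ z in Set.Iic 0, Real.exp z ∂γ
      = Real.exp (m + s ^ 2 / 2) * stdNormalCDF (-s - m / s) := by
    have e1 : -s - m / s = -(m + s ^ 2) / s := by
      field_simp
      ring
    rw [e1, ← hIic, ← integral_indicator measurableSet_Iic, hγ,
      integral_gaussianReal_eq_integral_smul hv, measureReal_def,
      gaussianReal_apply_eq_integral _ hv,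
      ENNReal.toReal_ofReal (setIntegral_nonneg measurableSet_Iic fun _ _ =>
        gaussianPDFReal_nonneg _ _ _), ← integral_const_mul,
      ← integral_indicator measurableSet_Iic]
    refine integral_congr_ae (ae_of_all _ fun z => ?_)
    by_cases hz : z ∈ Set.Iic (0 : ℝ)
    · simp only [Set.indicator_of_mem hz, smul_eq_mul, hshift]
    · simp only [Set.indicator_of_notMem hz, smul_zero]
  rw [hneg, smul_eq_mul, mul_one, add_comm]
  rfl

theorem acceptLimit_zero_zero : acceptLimit 0 0 = 1 := by
  have h : (gaussianReal 0 1).real (Set.Ioi 0) = stdNormalCDF 0 := by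
    have h : gaussianReal 0 1 = (gaussianReal 0 1).map (fun x => -x) := by
      rw [gaussianReal_map_neg, neg_zero]
    have : NullSingletonClass (gaussianReal 0 1) := nullSingletonClass_gaussianReal one_ne_zero
    rw [stdNormalCDF_eq]
    nth_rw 2 [h]
    rw [map_measureReal_apply (by fun_prop) measurableSet_Iic, Set.neg_preimage,
      Set.neg_Iic, neg_zero]
    exact measureReal_congr Ioi_ae_eq_Ici
  have h2 := probReal_add_probReal_compl (μ := gaussianReal 0 1)
    (measurableSet_Iic (a := (0 : ℝ)))
  rw [Set.compl_Iic, h, ← stdNormalCDF_eq] at h2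
  simpa [acceptLimit] using h2

theorem accept_eq_min_exp_logRatio {d : ℕ} {tden : (Fin d → ℝ) → ℝ}
    {qden : (Fin d → ℝ) → (Fin d → ℝ) → ℝ} (ht : ∀ x, 0 < tden x) (hq : ∀ x y, 0 < qden x y)
    (z : (Fin d → ℝ) × (Fin d → ℝ)) :
    accept tden qden z.1 z.2 = min 1 (Real.exp (logRatio tden qden z)) := by
  rw [accept, logRatio, Real.exp_log]
  exact div_pos (mul_pos (ht _) (hq _ _)) (mul_pos (ht _) (hq _ _))

theorem gaussDensity_pos {d : ℕ} {P : Matrix (Fin d) (Fin d) ℝ} (hP : 0 < P.det)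
    (m x : Fin d → ℝ) : 0 < gaussDensity m P x := by
  unfold gaussDensity
  positivity

/-- The function `z ↦ min 1 (exp z)`, whose expectation is the acceptance probability. -/
def minOneExp : BoundedContinuousFunction ℝ ℝ :=
  BoundedContinuousFunction.ofNormedAddCommGroup (fun z => min 1 (Real.exp z)) (by fun_prop) 1
    fun z => by
      rw [Real.norm_of_nonneg (le_min zero_le_one (Real.exp_pos z).le)]
      exact min_le_left _ _

theorem minOneExp_apply (z : ℝ) : minOneExp z = min 1 (Real.exp z) := rfl

/-- For MH with Gaussian target `N(A⁻¹b, A⁻¹)` and stochastic AR(1)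
proposal (`G`, `Σ` functions of `A`, `ρ(G) < 1`), in equilibrium: under the Lyapunov
condition and existence of the limits `μ`, `σ²`, the log acceptance ratio
`Z = log(π(y)q(y,x)/(π(x)q(x,y)))` converges in distribution to `N(μ, σ²)` and
`E[α(x,y)] → Φ(μ/σ) + e^{μ+σ²/2} Φ(−σ−μ/σ)` as `d → ∞`. -/
theorem stmt_6
    (A G S Q : (d : ℕ) → Matrix (Fin d) (Fin d) ℝ)
    (b g : (d : ℕ) → Fin d → ℝ)
    (lam2 Gev Sev : (d : ℕ) → Fin d → ℝ)
    -- `G` and `Σ` are functions of `A`: simultaneous orthogonal diagonalization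
    (hQ : ∀ d, (Q d)ᵀ * Q d = 1)
    (hA : ∀ d, A d = Q d * Matrix.diagonal (lam2 d) * (Q d)ᵀ)
    (hG : ∀ d, G d = Q d * Matrix.diagonal (Gev d) * (Q d)ᵀ)
    (hS : ∀ d, S d = Q d * Matrix.diagonal (Sev d) * (Q d)ᵀ)
    (hlam : ∀ d i, 0 < lam2 d i)
    (hSev : ∀ d i, 0 < Sev d i)
    -- `ρ(G) < 1`
    (hGev : ∀ d i, |Gev d i| < 1)
    -- eigenvalues `λ̃ᵢ²` of `𝒜 = Σ⁻¹(I - G²)`, and the eigen-components `μᵢ`, `μ̃ᵢ` of the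
    -- means `A⁻¹b` of the target and `(I-G)⁻¹g` of the proposal equilibrium
    (lamt2 muc mutc : (d : ℕ) → Fin d → ℝ)
    (hlamt2 : ∀ d i, lamt2 d i = (1 - Gev d i ^ 2) / Sev d i)
    (hmu : ∀ d, muc d = (Q d)ᵀ *ᵥ ((A d)⁻¹ *ᵥ b d))
    (hmut : ∀ d, mutc d = (Q d)ᵀ *ᵥ ((1 - G d)⁻¹ *ᵥ g d))
    -- the quantities `T_{ji}`
    (T : ℕ → (d : ℕ) → Fin d → ℝ)
    (hT0 : ∀ d i, T 0 d i = (muc d i - mutc d i) ^ 2 * lam2 d i *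
      ((1 / 2) * ((lam2 d i - lamt2 d i) / lam2 d i) * (1 - Gev d i ^ 2) - (1 - Gev d i)))
    (hT1 : ∀ d i, T 1 d i = (muc d i - mutc d i) * Real.sqrt (lam2 d i) *
      (((lam2 d i - lamt2 d i) / lam2 d i) * (1 - Gev d i ^ 2) - (1 - Gev d i)))
    (hT2 : ∀ d i, T 2 d i = (muc d i - mutc d i) * Real.sqrt (lam2 d i) *
      Real.sqrt ((lam2 d i / lamt2 d i) * (1 - Gev d i ^ 2)) *
      (1 - ((lam2 d i - lamt2 d i) / lam2 d i) * Gev d i))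
    (hT3 : ∀ d i, T 3 d i = (1 / 2) * ((lam2 d i - lamt2 d i) / lam2 d i) *
      (1 - Gev d i ^ 2))
    (hT4 : ∀ d i, T 4 d i = -(1 / 2) * ((lam2 d i - lamt2 d i) / lam2 d i) *
      (lam2 d i / lamt2 d i) * (1 - Gev d i ^ 2))
    (hT5 : ∀ d i, T 5 d i = -((lam2 d i - lamt2 d i) / lam2 d i) * Gev d i *
      Real.sqrt ((lam2 d i / lamt2 d i) * (1 - Gev d i ^ 2)))
    -- the Lyapunov condition, for some `δ > 0` and `j = 1,…,5`
    (δ : ℝ) (hδ : 0 < δ)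
    (hLyap : ∀ j ∈ Finset.Icc 1 5, Tendsto (fun d : ℕ =>
        (∑ i, |T j d i| ^ ((2 : ℝ) + δ)) / (∑ i, |T j d i| ^ 2) ^ ((1 : ℝ) + δ / 2))
      atTop (𝓝 0))
    -- existence of the limits `μ` and `σ²`
    (μl σ2 : ℝ)
    (hμ : Tendsto (fun d : ℕ => ∑ i, (T 0 d i + T 3 d i + T 4 d i)) atTop (𝓝 μl))
    (hσ : Tendsto (fun d : ℕ => ∑ i, ((T 1 d i) ^ 2 + (T 2 d i) ^ 2 + 2 * (T 3 d i) ^ 2 +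
        2 * (T 4 d i) ^ 2 + (T 5 d i) ^ 2)) atTop (𝓝 σ2))
    :
    (∀ f : BoundedContinuousFunction ℝ ℝ,
      Tendsto (fun d : ℕ =>
          ∫ pr, f (logRatio (gaussDensity ((A d)⁻¹ *ᵥ b d) (A d))
              (propDensity (G d) (g d) (S d)) pr)
            ∂(jointMeasure (gaussDensity ((A d)⁻¹ *ᵥ b d) (A d))
              (propDensity (G d) (g d) (S d))))
        atTop (𝓝 (∫ z, f z ∂(ProbabilityTheory.gaussianReal μl σ2.toNNReal)))) ∧
    Tendsto (fun d : ℕ => expAccept (gaussDensity ((A d)⁻¹ *ᵥ b d) (A d))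
        (propDensity (G d) (g d) (S d)))
      atTop (𝓝 (acceptLimit μl (Real.sqrt σ2))) := by
  have hmean (d : ℕ) : ∀ i, ((Q d)ᵀ *ᵥ g d) i = (1 - Gev d i) * mutc d i :=
    transpose_mulVec_eq_of_eq_inv_mulVec (hQ d) (hG d) (hGev d) (hmut d)
  set J := fun d => jointMeasure (gaussDensity ((A d)⁻¹ *ᵥ b d) (A d))
    (propDensity (G d) (g d) (S d)) with hJ
  set L := fun d => logRatio (gaussDensity ((A d)⁻¹ *ᵥ b d) (A d))
    (propDensity (G d) (g d) (S d)) with hL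
  have hJprob (d : ℕ) : IsProbabilityMeasure (J d) :=
    isProbabilityMeasure_jointMeasure (hQ d) (hA d) (hG d) (hS d) (hlam d) (hSev d) (hmu d)
      (hmean d)
  have hLmeas (d : ℕ) : Measurable (L d) := measurable_logRatio _ _ _ _ _
  have hσ' : Tendsto (fun d : ℕ => ∑ i, quadraticVariance (fun j => T j d i)) atTop (𝓝 σ2) := hσ
  have hσ0 : 0 ≤ σ2 := ge_of_tendsto' hσ' fun d =>
    Finset.sum_nonneg fun i _ => quadraticVariance_nonneg _
  have hchar (t : ℝ) : Tendsto (fun d => charFun ((J d).map (L d)) t) atTop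
      (𝓝 (charFun (gaussianReal μl σ2.toNNReal) t)) := by
    have h1 (d : ℕ) : charFun ((J d).map (L d)) t
        = Complex.exp ((t * ∑ i, (T 0 d i + T 3 d i + T 4 d i) : ℝ) * Complex.I) *
          ∏ i, ∫ p, Complex.exp ((t * centredQuadratic (fun j => T j d i) p : ℝ) * Complex.I)
            ∂stdGaussianPair := by
      rw [charFun_apply_real, integral_map (hLmeas d).aemeasurable (by fun_prop)]
      have h := integral_cexp_logRatio (hQ d) (hA d) (hG d) (hS d) (hlam d) (hSev d) (hmu d)
        (hmean d) t
      simp only [Complex.ofReal_mul] at h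
      simp only [hJ, hL]
      rw [h, Finset.mul_sum, Complex.ofReal_sum, Finset.sum_mul, Complex.exp_sum,
        ← Finset.prod_mul_distrib]
      refine Finset.prod_congr rfl fun i _ => ?_
      rw [← integral_const_mul]
      refine integral_congr_ae (ae_of_all _ fun p => ?_)
      simp only
      rw [pairLogRatio_stateProposal (hlam d i) (hSev d i) (hGev d i) _ _ (fun j => T j d i)
        (hlamt2 d i) (hT0 d i) (hT1 d i) (hT2 d i) (hT3 d i) (hT4 d i) (hT5 d i),
        ← Complex.exp_add]
      congr 1
      push_cast
      ring
    simp_rw [h1]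
    have h2 : Tendsto (fun d : ℕ => Complex.exp
        ((t * ∑ i, (T 0 d i + T 3 d i + T 4 d i) : ℝ) * Complex.I)) atTop
        (𝓝 (Complex.exp ((t * μl : ℝ) * Complex.I))) := by
      have hc : Continuous fun x : ℝ => Complex.exp ((t * x : ℝ) * Complex.I) := by fun_prop
      exact (hc.tendsto μl).comp hμ
    convert h2.mul (tendsto_prod_integral_cexp_centredQuadratic hδ T hLyap hσ' t) using 2
    rw [charFun_gaussianReal, ← Complex.exp_add, Real.coe_toNNReal _ hσ0]
    congr 1
    push_cast
    ring
  have hconv (f : BoundedContinuousFunction ℝ ℝ) : Tendsto (fun d => ∫ pr, f (L d pr) ∂(J d))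
      atTop (𝓝 (∫ z, f z ∂(gaussianReal μl σ2.toNNReal))) := by
    let ν (d : ℕ) : ProbabilityMeasure ℝ :=
      ⟨(J d).map (L d), Measure.isProbabilityMeasure_map (hLmeas d).aemeasurable⟩
    let γ : ProbabilityMeasure ℝ := ⟨gaussianReal μl σ2.toNNReal, inferInstance⟩
    have h : Tendsto ν atTop (𝓝 γ) := ProbabilityMeasure.tendsto_of_tendsto_charFun hchar
    refine (ProbabilityMeasure.tendsto_iff_forall_integral_tendsto.1 h f).congr fun d => ?_
    exact integral_map (hLmeas d).aemeasurable f.continuous.aestronglyMeasurable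
  refine ⟨hconv, ?_⟩
  have hdetA (d : ℕ) : 0 < (A d).det := by
    rw [hA d, det_conj_diagonal (hQ d)]
    exact Finset.prod_pos fun i _ => hlam d i
  have hdetS (d : ℕ) : 0 < (S d)⁻¹.det := by
    rw [hS d, inv_conj_diagonal (hQ d) fun i => (hSev d i).ne', det_conj_diagonal (hQ d)]
    exact Finset.prod_pos fun i _ => inv_pos.2 (hSev d i)
  have hacc (d : ℕ) : ∫ pr, minOneExp (L d pr) ∂(J d)
      = expAccept (gaussDensity ((A d)⁻¹ *ᵥ b d) (A d)) (propDensity (G d) (g d) (S d)) := by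
    refine integral_congr_ae (ae_of_all _ fun pr => ?_)
    exact (accept_eq_min_exp_logRatio (fun x => gaussDensity_pos (hdetA d) _ _)
      (fun x y => gaussDensity_pos (hdetS d) _ _) pr).symm
  have hlim : ∫ z, minOneExp z ∂(gaussianReal μl σ2.toNNReal) = acceptLimit μl (Real.sqrt σ2) := by
    rcases hσ0.eq_or_lt with h0 | hpos
    · have hμ0 : μl = 0 := by
        rw [← h0] at hσ'
        refine tendsto_nhds_unique hμ (squeeze_zero_norm' ?_ (by simpa using hσ'.const_mul 3))
        filter_upwards [eventually_coeffSize_le hδ T hLyap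
          (hσ'.eventually_le_const zero_lt_one) zero_lt_one] with d hd
        rw [Finset.mul_sum]
        refine (norm_sum_le _ _).trans (Finset.sum_le_sum fun i _ => ?_)
        exact abs_drift_le (hlam d i) (hSev d i) (hGev d i) _ _ (fun j => T j d i)
          (hlamt2 d i) (hT0 d i) (hT1 d i) (hT2 d i) (hT3 d i) (hT4 d i) (hT5 d i) (hd i)
      rw [← h0, hμ0, Real.sqrt_zero, acceptLimit_zero_zero, Real.toNNReal_zero,
        gaussianReal_zero_var, integral_dirac, minOneExp_apply, Real.exp_zero, min_self]
    · have h := integral_min_one_exp_gaussianReal μl (Real.sqrt_pos.2 hpos)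
      rwa [Real.sq_sqrt hσ0] at h
  rw [← hlim]
  exact (hconv minOneExp).congr hacc

end AR1
end
end

section
/- With the definitions of Theorem on expected acceptance probability (μ being the limit of ∑_{i=1}^d (T_{0i}+T_{3i}+T_{4i})): if lim_{d→∞} ∑_{i=1}^d ((λ_i²−λ̃_i²)²/(λ_i² λ̃_i²))(1−G_i²) and lim_{d→∞} ∑_{i=1}^d r̂_i² λ_i² (1−G_i) are bounded, and lim_{d→∞} ∑_{i=1}^d r̂_i² (λ_i²−λ̃_i²)(1−G_i²) is bounded below, then μ > −∞. In particular, μ equals lim_{d→∞} ∑_{i=1}^d ( −½ ((λ_i²−λ̃_i²)²/(λ_i² λ̃_i²))(1−G_i²) − r̂_i² λ_i² (1−G_i) + ½ r̂_i² (λ_i²−λ̃_i²)(1−G_i²) ). -/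
noncomputable section

open MeasureTheory Matrix Filter Topology

namespace AR1

/-- With the notation of the acceptance-probability theorem, if the
limits of `∑ᵢ ((λᵢ²−λ̃ᵢ²)²/(λᵢ²λ̃ᵢ²))(1−Gᵢ²)` and `∑ᵢ r̂ᵢ²λᵢ²(1−Gᵢ)` are bounded and
`∑ᵢ r̂ᵢ²(λᵢ²−λ̃ᵢ²)(1−Gᵢ²)` is bounded below, then `μ > −∞` (the sums defining `μ` are
bounded below); moreover `∑ᵢ (T₀ᵢ+T₃ᵢ+T₄ᵢ)` equals termwise
`−½((λᵢ²−λ̃ᵢ²)²/(λᵢ²λ̃ᵢ²))(1−Gᵢ²) − r̂ᵢ²λᵢ²(1−Gᵢ) + ½r̂ᵢ²(λᵢ²−λ̃ᵢ²)(1−Gᵢ²)`. -/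
theorem stmt_7
    (lam2 lamt2 Gev muc mutc : (d : ℕ) → Fin d → ℝ)
    (hlam : ∀ d i, 0 < lam2 d i)
    (hlamt : ∀ d i, 0 < lamt2 d i)
    (hGev : ∀ d i, |Gev d i| < 1)
    (T : ℕ → (d : ℕ) → Fin d → ℝ)
    (hT0 : ∀ d i, T 0 d i = (muc d i - mutc d i) ^ 2 * lam2 d i *
      ((1 / 2) * ((lam2 d i - lamt2 d i) / lam2 d i) * (1 - Gev d i ^ 2) - (1 - Gev d i)))
    (hT3 : ∀ d i, T 3 d i = (1 / 2) * ((lam2 d i - lamt2 d i) / lam2 d i) *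
      (1 - Gev d i ^ 2))
    (hT4 : ∀ d i, T 4 d i = -(1 / 2) * ((lam2 d i - lamt2 d i) / lam2 d i) *
      (lam2 d i / lamt2 d i) * (1 - Gev d i ^ 2))
    (L1 L2 : ℝ)
    (h1 : Tendsto (fun d : ℕ => ∑ i,
        ((lam2 d i - lamt2 d i) ^ 2 / (lam2 d i * lamt2 d i)) * (1 - Gev d i ^ 2))
      atTop (𝓝 L1))
    (h2 : Tendsto (fun d : ℕ => ∑ i,
        (muc d i - mutc d i) ^ 2 * lam2 d i * (1 - Gev d i)) atTop (𝓝 L2))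
    (h3 : ∃ C : ℝ, ∀ᶠ d : ℕ in atTop, C ≤ ∑ i,
        (muc d i - mutc d i) ^ 2 * (lam2 d i - lamt2 d i) * (1 - Gev d i ^ 2)) :
    (∃ C : ℝ, ∀ᶠ d : ℕ in atTop, C ≤ ∑ i, (T 0 d i + T 3 d i + T 4 d i)) ∧
    (∀ d i, T 0 d i + T 3 d i + T 4 d i =
      -(1 / 2) * ((lam2 d i - lamt2 d i) ^ 2 / (lam2 d i * lamt2 d i)) * (1 - Gev d i ^ 2)
        - (muc d i - mutc d i) ^ 2 * lam2 d i * (1 - Gev d i)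
        + (1 / 2) * (muc d i - mutc d i) ^ 2 * (lam2 d i - lamt2 d i) * (1 - Gev d i ^ 2)) := by
  have key : ∀ d i, T 0 d i + T 3 d i + T 4 d i =
      -(1 / 2) * ((lam2 d i - lamt2 d i) ^ 2 / (lam2 d i * lamt2 d i)) * (1 - Gev d i ^ 2)
        - (muc d i - mutc d i) ^ 2 * lam2 d i * (1 - Gev d i)
        + (1 / 2) * (muc d i - mutc d i) ^ 2 * (lam2 d i - lamt2 d i) *
          (1 - Gev d i ^ 2) := by
    intro d i
    have hl := (hlam d i).ne'
    have ht := (hlamt d i).ne'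
    rw [hT0, hT3, hT4]
    field_simp
    ring
  refine ⟨?_, key⟩
  obtain ⟨C, hC⟩ := h3
  refine ⟨-(1 / 2) * (L1 + 1) - (L2 + 1) + (1 / 2) * C, ?_⟩
  filter_upwards [hC, h1.eventually_lt_const (lt_add_one L1),
    h2.eventually_lt_const (lt_add_one L2)] with d hd3 hd1 hd2
  simp only [key, Finset.sum_add_distrib, Finset.sum_sub_distrib, mul_assoc,
    ← Finset.mul_sum] at hd1 hd2 hd3 ⊢
  linarith

end AR1
end
end
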